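/- arXiv:0908.1072 — 2 statements merged into one kernel-verified Lean document; each statement's English description precedes it below -/
import Mathlib

section
/- Let (ξᵢ)_{i∈ℕ} be independent identically distributed square-integrable real random variables with E[ξ₁] = a and Var(ξ₁) = σ². For each t > 0 let N_t be a random variable with the Poisson distribution of parameter t, independent of the whole sequence (ξᵢ). Then the distribution of (∑_{i=1}^{N_t} ξᵢ − a·t)/√t converges weakly, as t → ∞, to the centered Gaussian distribution with variance σ² + a² on ℝ. (One-dimensional marginal form of Corollary 1.) -/
open MeasureTheory ProbabilityTheory Filter Topology NNReal

lemma aux_meas (b : ℝ → ℝ) (hb : Measurable b) :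
    Measurable (fun p : ℕ × (ℕ → ℝ) => b (∑ i ∈ Finset.range p.1, p.2 i)) := by
  apply measurable_from_prod_countable_right
  intro n
  simp only
  fun_prop

lemma aux_charFun
    {Ω : Type*} [MeasurableSpace Ω] (P : Measure Ω) [IsProbabilityMeasure P]
    (ξ : ℕ → Ω → ℝ)
    (hmeas : ∀ i, Measurable (ξ i))
    (hindep : iIndepFun ξ P)
    (hident : ∀ i, IdentDistrib (ξ i) (ξ 0) P P)
    (N : Ω → ℕ) (hN : Measurable N) (t : ℝ≥0)
    (hNdist : Measure.map N P = poissonMeasure t)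
    (hNindep : IndepFun N (fun ω => fun i : ℕ => ξ i ω) P) (s : ℝ) :
    charFun (P.map (fun ω => ∑ i ∈ Finset.range (N ω), ξ i ω)) s =
      Complex.exp (t * (charFun (P.map (ξ 0)) s - 1)) := by
  have hX : Measurable (fun ω => fun i : ℕ => ξ i ω) := measurable_pi_lambda _ hmeas
  have hS : Measurable (fun p : ℕ × (ℕ → ℝ) => ∑ i ∈ Finset.range p.1, p.2 i) :=
    aux_meas id measurable_id
  have hprod := hNindep.map_prod_eq_prod_map_map hN.aemeasurable hX.aemeasurable
  have h1 : P.map (fun ω => ∑ i ∈ Finset.range (N ω), ξ i ω) =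
      ((P.map N).prod (P.map (fun ω => fun i : ℕ => ξ i ω))).map
        (fun p : ℕ × (ℕ → ℝ) => ∑ i ∈ Finset.range p.1, p.2 i) := by
    rw [← hprod, Measure.map_map hS (hN.prodMk hX)]
    rfl
  have : IsProbabilityMeasure (P.map (fun ω => fun i : ℕ => ξ i ω)) :=
    Measure.isProbabilityMeasure_map hX.aemeasurable
  have : IsProbabilityMeasure (P.map N) :=
    Measure.isProbabilityMeasure_map hN.aemeasurable
  have hn : ∀ n : ℕ, ∫ x : ℕ → ℝ, Complex.exp (s * (∑ i ∈ Finset.range n, x i : ℝ) * Complex.I)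
      ∂(P.map (fun ω => fun i : ℕ => ξ i ω)) = charFun (P.map (ξ 0)) s ^ n := by
    intro n
    rw [integral_map hX.aemeasurable (Measurable.aestronglyMeasurable (by fun_prop))]
    have := (hindep.restrict (Finset.range n)).charFun_map_fun_finsetSum_eq_prod
      (fun i _ => (hmeas i).aemeasurable)
    have h2 := congrFun this s
    rw [charFun_apply_real, integral_map (by fun_prop) (by fun_prop)] at h2
    rw [h2]
    simp [fun i ↦ (hident i).map_eq]
  have hmb : Measurable (fun p : ℕ × (ℕ → ℝ) =>
      Complex.exp (s * (∑ i ∈ Finset.range p.1, p.2 i : ℝ) * Complex.I)) := by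
    have : Measurable (fun y : ℝ => Complex.exp (s * (y : ℂ) * Complex.I)) := by fun_prop
    exact this.comp hS
  rw [h1, charFun_apply_real, integral_map hS.aemeasurable (by fun_prop), integral_prod]
  · simp only [hn]
    rw [hNdist, integral_poissonMeasure]
    set z := charFun (P.map (ξ 0)) s
    calc ∑' a : ℕ, (Real.exp (-t) * t ^ a / a.factorial : ℝ) • z ^ a
      _ = ∑' a : ℕ, (Real.exp (-t) : ℂ) * ((t * z) ^ a / a.factorial) := by
          congr with a
          rw [Complex.real_smul]
          push_cast
          rw [mul_pow]
          ring
      _ = (Real.exp (-t) : ℂ) * ∑' a : ℕ, ((t * z) ^ a / a.factorial) := tsum_mul_left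
      _ = (Real.exp (-t) : ℂ) * Complex.exp (t * z) := by
          rw [(NormedSpace.expSeries_div_hasSum_exp ((t : ℂ) * z)).tsum_eq, Complex.exp_eq_exp_ℂ]
      _ = Complex.exp (t * (z - 1)) := by
          rw [Complex.ofReal_exp, ← Complex.exp_add]
          push_cast
          ring_nf
  · refine Integrable.of_bound hmb.aestronglyMeasurable 1 (ae_of_all _ fun p => ?_)
    rw [← Complex.ofReal_mul, Complex.norm_exp_ofReal_mul_I]

lemma aux_taylor
    {Ω : Type*} [MeasurableSpace Ω] (P : Measure Ω) [IsProbabilityMeasure P]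
    (X : Ω → ℝ) (a m : ℝ) (hX : Measurable X) (hL2 : MemLp X 2 P)
    (hmean : ∫ ω, X ω ∂P = a) (hm : P[X ^ 2] = m) :
    (fun u : ℝ => charFun (P.map X) u - (1 + a * u * Complex.I - m * u ^ 2 / 2))
      =o[𝓝 0] fun u => u ^ 2 := by
  have : IsProbabilityMeasure (P.map X) := Measure.isProbabilityMeasure_map hX.aemeasurable
  have hint : MemLp id 2 (P.map X) :=
    (memLp_map_measure_iff (by fun_prop) hX.aemeasurable).2 hL2
  have h := fun t => taylorWithinEval_charFun_two_zero hX.aemeasurable hint t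
  rw [hmean, hm] at h
  simp_rw [← h]
  have h3 := taylor_isLittleO_univ (f := charFun (P.map X)) (n := 2) (x₀ := 0)
    (contDiff_charFun (n := 2) (by exact_mod_cast hint))
  simpa using h3

lemma aux_limit (φ : ℝ → ℂ) (a m s : ℝ)
    (h : (fun u : ℝ => φ u - (1 + a * u * Complex.I - m * u ^ 2 / 2)) =o[𝓝 0] fun u => u ^ 2) :
    Tendsto (fun t : ℝ≥0 => (t : ℂ) * (φ (s / Real.sqrt t) - 1) -
      a * s * Real.sqrt t * Complex.I) atTop (𝓝 (-(m * s ^ 2 / 2))) := by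
  have hsq : Tendsto (fun t : ℝ≥0 => Real.sqrt t) atTop atTop :=
    Real.tendsto_sqrt_atTop.comp (NNReal.tendsto_coe_atTop.2 tendsto_id)
  have h0 : Tendsto (fun t : ℝ≥0 => s / Real.sqrt t) atTop (𝓝 0) :=
    hsq.const_div_atTop s
  have h1 := h.comp_tendsto h0
  have h2 : (fun t : ℝ≥0 => (t : ℂ) * (φ (s / Real.sqrt t) -
      (1 + a * (s / Real.sqrt t : ℝ) * Complex.I - m * (s / Real.sqrt t : ℝ) ^ 2 / 2)))
      =o[atTop] fun _ => (1 : ℝ) := by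
    have hb : (fun t : ℝ≥0 => ((t : ℝ) : ℂ)) =O[atTop] fun t : ℝ≥0 => (t : ℝ) :=
      Asymptotics.isBigO_of_le _ fun t => by simp
    refine (hb.mul_isLittleO h1).trans_isBigO ?_
    refine (Asymptotics.isBigO_const_const (s ^ 2) (one_ne_zero (α := ℝ)) atTop).congr' ?_ .rfl
    filter_upwards [eventually_gt_atTop 0] with t ht
    have ht' : (0:ℝ) < t := by exact_mod_cast ht
    simp only [Function.comp, div_pow, Real.sq_sqrt ht'.le]
    field_simp
  have h3 := (Asymptotics.isLittleO_one_iff ℝ).1 h2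
  have h4 := h3.add_const (-(m * s ^ 2 / 2) : ℂ)
  rw [zero_add] at h4
  refine h4.congr' ?_
  filter_upwards [eventually_gt_atTop 0] with t ht
  have ht' : (0:ℝ) < t := by exact_mod_cast ht
  have hr : (Real.sqrt t : ℂ) ≠ 0 := by exact_mod_cast (Real.sqrt_pos.2 ht').ne'
  have hrt : ((t : ℝ) : ℂ) = (Real.sqrt t : ℂ) ^ 2 := by
    rw [← Complex.ofReal_pow, Real.sq_sqrt ht'.le]
  rw [hrt]
  push_cast
  field_simp
  ring

/-- **One-dimensional marginal form of Corollary 1.**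
If `(ξᵢ)` are i.i.d. square-integrable with mean `a` and variance `σ²`, and for each `t`
the random variable `N t` is Poisson of parameter `t`, independent of the whole sequence
`(ξᵢ)`, then the distribution of `(∑_{i<N t} ξᵢ - a t)/√t` converges weakly, as `t → ∞`,
to the centered Gaussian distribution with variance `σ² + a²`. -/
theorem stmt7
    {Ω : Type*} [MeasurableSpace Ω] (P : Measure Ω) [IsProbabilityMeasure P]
    (ξ : ℕ → Ω → ℝ) (a σ : ℝ)
    (hmeas : ∀ i, Measurable (ξ i))
    (hindep : iIndepFun ξ P)
    (hident : ∀ i, IdentDistrib (ξ i) (ξ 0) P P)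
    (hL2 : MemLp (ξ 0) 2 P)
    (hmean : ∫ ω, ξ 0 ω ∂P = a)
    (hvar : variance (ξ 0) P = σ ^ 2)
    (N : ℝ≥0 → Ω → ℕ)
    (hNmeas : ∀ t, Measurable (N t))
    (hNdist : ∀ t : ℝ≥0, 0 < t → Measure.map (N t) P = poissonMeasure t)
    (hNindep : ∀ t : ℝ≥0, IndepFun (N t) (fun ω => fun i : ℕ => ξ i ω) P) :
    ∀ g : BoundedContinuousFunction ℝ ℝ,
      Tendsto (fun t : ℝ≥0 =>
          ∫ ω, g ((∑ i ∈ Finset.range (N t ω), ξ i ω - a * t) / Real.sqrt t) ∂P) atTop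
        (𝓝 (∫ y, g y ∂(gaussianReal 0 (σ ^ 2 + a ^ 2).toNNReal))) := by
  intro g
  have hmeasS : ∀ t, Measurable (fun ω => ∑ i ∈ Finset.range (N t ω), ξ i ω) := fun t =>
    (aux_meas id measurable_id).comp ((hNmeas t).prodMk (measurable_pi_lambda _ hmeas))
  have hmeasY : ∀ t : ℝ≥0, Measurable
      (fun ω => (∑ i ∈ Finset.range (N t ω), ξ i ω - a * t) / Real.sqrt t) := fun t =>
    ((hmeasS t).sub_const _).div_const _
  have hm : P[(ξ 0) ^ 2] = σ ^ 2 + a ^ 2 := by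
    have := variance_eq_sub hL2
    rw [hvar, hmean] at this
    linarith
  have htay := aux_taylor P (ξ 0) a (σ ^ 2 + a ^ 2) (hmeas 0) hL2 hmean hm
  apply tendsto_of_seq_tendsto
  intro x hx
  let μ : ℕ → ProbabilityMeasure ℝ := fun n =>
    ⟨P.map (fun ω => (∑ i ∈ Finset.range (N (x n) ω), ξ i ω - a * (x n)) / Real.sqrt (x n)),
      Measure.isProbabilityMeasure_map (hmeasY _).aemeasurable⟩
  let μ₀ : ProbabilityMeasure ℝ := ⟨gaussianReal 0 (σ ^ 2 + a ^ 2).toNNReal, inferInstance⟩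
  have key : Tendsto μ atTop (𝓝 μ₀) := by
    refine ProbabilityMeasure.tendsto_iff_tendsto_charFun.2 fun s => ?_
    have hlim := (Complex.continuous_exp.tendsto _).comp
      ((aux_limit (charFun (P.map (ξ 0))) a (σ ^ 2 + a ^ 2) s htay).comp hx)
    have hg : charFun (μ₀ : Measure ℝ) s =
        Complex.exp (-(((σ ^ 2 + a ^ 2 : ℝ) : ℂ) * s ^ 2 / 2)) := by
      change charFun (gaussianReal 0 (σ ^ 2 + a ^ 2).toNNReal) s = _
      rw [charFun_gaussianReal, Real.coe_toNNReal _ (by positivity)]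
      simp
    rw [hg]
    refine hlim.congr' ?_
    filter_upwards [hx.eventually_gt_atTop 0] with n hn
    have hn' : (0:ℝ) < x n := by exact_mod_cast hn
    have hc := aux_charFun P ξ hmeas hindep hident (N (x n)) (hNmeas _) (x n) (hNdist _ hn)
      (hNindep _) (s / Real.sqrt (x n))
    change _ = charFun (P.map (fun ω => (∑ i ∈ Finset.range (N (x n) ω), ξ i ω - a * (x n)) /
      Real.sqrt (x n))) s
    rw [charFun_apply_real, integral_map (hmeasS _).aemeasurable (by fun_prop)] at hc
    rw [charFun_apply_real, integral_map (hmeasY _).aemeasurable (by fun_prop)]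
    simp only [Function.comp]
    rw [Complex.exp_sub, ← hc, div_eq_mul_inv, ← Complex.exp_neg, ← integral_mul_const]
    congr 1
    ext ω
    rw [← Complex.exp_add]
    congr 1
    have hr : (Real.sqrt (x n) : ℂ) ≠ 0 := by exact_mod_cast (Real.sqrt_pos.2 hn').ne'
    have hrt : ((x n : ℝ) : ℂ) = (Real.sqrt (x n) : ℂ) ^ 2 := by
      rw [← Complex.ofReal_pow, Real.sq_sqrt hn'.le]
    simp only [Complex.ofReal_div, Complex.ofReal_sub, Complex.ofReal_mul]
    rw [hrt]
    field_simp
    ring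
  have h := ProbabilityMeasure.tendsto_iff_forall_integral_tendsto.1 key g
  refine h.congr fun n => ?_
  exact integral_map (hmeasY _).aemeasurable g.continuous.aestronglyMeasurable
end

section
/- Assume f : [1,∞) → (0,∞) satisfies condition (B): for some β > 0 the function x ↦ f(x)/x^β is increasing; assume d : [1,∞) → (0,∞) satisfies condition (C): d is decreasing, ∫_k^{k+1} d(s) ds ≤ log √((k+1)/k) for all k ∈ ℕ, and ∫_1^∞ d(s) ds = +∞; set D(S) = ∫_1^S d(s) ds. Assume moreover that (s, ω) ↦ V(f(s), ω) is jointly measurable. Then for almost every ω ∈ Ω, for every bounded continuous function g : ℝ → ℝ, one has (1/D(S)) ∫_1^S g(V(f(s), ω)/√f(s))·d(s) ds → ∫ g dN(0, σ²) as S → ∞; that is, the random measures Q_S^I(ω) = (1/D(S)) ∫_1^S δ_{V(f(s),ω)/√f(s)} d(s) ds converge weakly to N(0, σ²) almost surely. (One-dimensional marginal form of Theorem 4.) -/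
open MeasureTheory ProbabilityTheory Filter Topology NNReal

/-- Standing hypotheses on the process. -/
structure LevyH {Ω : Type*} [MeasurableSpace Ω] (P : Measure Ω) (V : ℝ → Ω → ℝ) (σ : ℝ≥0) :
    Prop where
  hVmeas : ∀ t, Measurable (V t)
  hV0 : ∀ᵐ ω ∂P, V 0 ω = 0
  hindep : ∀ (k : ℕ) (t : Fin (k + 1) → ℝ), Monotone t → 0 ≤ t 0 →
      iIndepFun
        (fun i : Fin k => fun ω => V (t i.succ) ω - V (t i.castSucc) ω) P
  hstat : ∀ s t : ℝ, 0 ≤ s → s ≤ t →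
      Measure.map (fun ω => V t ω - V s ω) P = Measure.map (V (t - s)) P
  hL2 : MemLp (V 1) 2 P
  hcent : ∫ ω, V 1 ω ∂P = 0
  hvar : ∫ ω, (V 1 ω) ^ 2 ∂P = (σ : ℝ) ^ 2

lemma memLp_left_of_add {Ω : Type*} [MeasurableSpace Ω] {P : Measure Ω} [IsProbabilityMeasure P]
    {X Y : Ω → ℝ} (hX : Measurable X) (hY : Measurable Y) (h : IndepFun X Y P)
    (hXY : MemLp (fun ω => X ω + Y ω) 2 P) : MemLp X 2 P := by
  have h1 := (indepFun_iff_map_prod_eq_prod_map_map hX.aemeasurable hY.aemeasurable).1 h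
  have h2 : MemLp (fun p : ℝ × ℝ => p.1 + p.2) 2 ((P.map X).prod (P.map Y)) := by
    rw [← h1]
    rw [memLp_map_measure_iff (by fun_prop) (by fun_prop)]
    exact hXY
  have : IsProbabilityMeasure (P.map X) := Measure.isProbabilityMeasure_map hX.aemeasurable
  have : IsProbabilityMeasure (P.map Y) := Measure.isProbabilityMeasure_map hY.aemeasurable
  have h3 := h2.integrable_sq
  have h4 := h3.prod_left_ae
  obtain ⟨y, hy⟩ := h4.exists
  have h5 : MemLp (fun x : ℝ => x + y) 2 (P.map X) :=
    (memLp_two_iff_integrable_sq (by fun_prop)).2 hy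
  have h6 : MemLp (fun x : ℝ => x) 2 (P.map X) := by
    have := h5.sub (memLp_const y)
    convert! this using 1
    ext x; simp
  rw [memLp_map_measure_iff (by fun_prop) (by fun_prop)] at h6
  exact h6

lemma additive_nsmul {v : ℝ → ℝ} (hadd : ∀ s t, 0 ≤ s → 0 ≤ t → v (s + t) = v s + v t)
    (n : ℕ) {t : ℝ} (ht : 0 ≤ t) : v (n * t) = n * v t := by
  induction n with
  | zero =>
    have := hadd 0 0 le_rfl le_rfl
    simp at this ⊢
    exact this
  | succ n ih =>
    push_cast
    rw [add_mul, one_mul, hadd _ _ (by positivity) ht, ih]; ring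

lemma additive_nonneg {v : ℝ → ℝ} (hadd : ∀ s t, 0 ≤ s → 0 ≤ t → v (s + t) = v s + v t)
    (hpos : ∀ t, 0 ≤ t → 0 ≤ v t) {t : ℝ} (ht : 0 ≤ t) : v t = t * v 1 := by
  have hmono : ∀ s t, 0 ≤ s → s ≤ t → v s ≤ v t := by
    intro s t hs hst
    have := hadd s (t - s) hs (by linarith)
    have h2 := hpos (t - s) (by linarith)
    rw [add_sub_cancel] at this
    linarith
  have h1 : 0 ≤ v 1 := hpos 1 zero_le_one
  have hnat : ∀ n : ℕ, v n = n * v 1 := fun n => by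
    simpa using additive_nsmul hadd n zero_le_one
  have key : ∀ n : ℕ, n * |v t - t * v 1| ≤ v 1 := by
    intro n
    have hn : v (n * t) = n * v t := additive_nsmul hadd n ht
    have hnt : (0:ℝ) ≤ n * t := by positivity
    have a1 := hmono _ _ (by positivity) (Nat.floor_le hnt)
    have a2 := hmono _ _ hnt (Nat.lt_floor_add_one (n * t)).le
    have b1 := hnat ⌊n * t⌋₊
    have b2 := hnat (⌊n * t⌋₊ + 1)
    push_cast at b2
    have c1 := Nat.floor_le hnt
    have c2 := (Nat.lt_floor_add_one (n * t)).le
    rw [b1, hn] at a1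
    rw [b2, hn] at a2
    have e : n * |v t - t * v 1| = |n * v t - n * t * v 1| := by
      rw [← abs_of_nonneg (Nat.cast_nonneg n : (0:ℝ) ≤ n), ← abs_mul, abs_of_nonneg (Nat.cast_nonneg n : (0:ℝ) ≤ n)]
      congr 1; ring
    rw [e, abs_le]
    constructor <;> nlinarith
  by_contra hne
  have hp : 0 < |v t - t * v 1| := abs_pos.2 (sub_ne_zero.2 hne)
  obtain ⟨n, hn⟩ := exists_nat_gt (v 1 / |v t - t * v 1|)
  rw [div_lt_iff₀ hp] at hn
  linarith [key n]

/-- Steinhaus-type argument. -/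
lemma additive_zero {m : ℝ → ℝ} (hadd : ∀ s t, 0 ≤ s → 0 ≤ t → m (s + t) = m s + m t)
    (h1 : m 1 = 0) (f : ℝ → ℝ) (hf_pos : ∀ x, 1 ≤ x → 0 < f x)
    (β : ℝ) (hβ : 0 < β)
    (hB : ∀ x y : ℝ, 1 ≤ x → x ≤ y → f x / x ^ β ≤ f y / y ^ β)
    (hmeas : Measurable fun s => m (f s)) {t : ℝ} (ht : 0 ≤ t) : m t = 0 := by
  have hinc : ∀ x y, 1 ≤ x → x ≤ y → y ≤ 2 → f 1 * β / 2 * (y - x) ≤ f y - f x := by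
    intro x y hx hxy hy
    have hx0 : 0 < x := by linarith
    have hy0 : 0 < y := by linarith
    have i1 : f x * (y / x) ^ β ≤ f y := by
      have := hB x y hx hxy
      rw [div_le_div_iff₀ (by positivity) (by positivity)] at this
      rw [Real.div_rpow hy0.le hx0.le, ← mul_div_assoc, div_le_iff₀ (by positivity)]
      exact this
    have i2 : f 1 ≤ f x := by
      have := hB 1 x le_rfl hx
      rw [Real.one_rpow, div_one, le_div_iff₀ (by positivity)] at this
      have h3 : 1 ≤ x ^ β := Real.one_le_rpow hx hβ.le
      nlinarith [hf_pos 1 le_rfl]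
    have i3 : 1 + β * ((y - x) / 2) ≤ (y / x) ^ β := by
      rw [Real.rpow_def_of_pos (by positivity)]
      have l1 := Real.one_sub_inv_le_log_of_pos (show 0 < y / x by positivity)
      have l2 : (y - x) / 2 ≤ 1 - (y / x)⁻¹ := by
        rw [inv_div, one_sub_div hy0.ne', div_le_div_iff₀ (by norm_num) hy0]
        nlinarith
      have l3 := Real.add_one_le_exp (Real.log (y / x) * β)
      nlinarith
    have := hf_pos 1 le_rfl
    have i4 : 0 ≤ β * ((y - x) / 2) := by
      apply mul_nonneg hβ.le; linarith
    nlinarith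
  set c := f 1 * β / 2 with hc
  have hcpos : 0 < c := by have := hf_pos 1 le_rfl; positivity
  -- the set
  let E : ℕ → Set ℝ := fun M => Set.Icc 1 2 ∩ {s | |m (f s)| ≤ M}
  have hEm : ∀ M, MeasurableSet (E M) := fun M =>
    measurableSet_Icc.inter (measurableSet_le (continuous_abs.measurable.comp hmeas) measurable_const)
  have hU : (⋃ M, E M) = Set.Icc 1 2 := by
    ext s
    simp only [E, Set.mem_iUnion, Set.mem_inter_iff, Set.mem_ofPred_eq]
    constructor
    · rintro ⟨_, h, _⟩; exact h
    · intro h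
      obtain ⟨n, hn⟩ := exists_nat_ge |m (f s)|
      exact ⟨n, h, hn⟩
  obtain ⟨M, hM⟩ : ∃ M, 0 < volume (E M) := by
    by_contra! hcon
    have : volume (⋃ M, E M) = 0 := measure_iUnion_null fun M => le_antisymm (hcon M) zero_le
    rw [hU] at this
    simp at this
  have hinj : Set.InjOn f (E M) := by
    intro x hx y hy hxy
    rcases le_total x y with h | h
    · have := hinc x y hx.1.1 h hy.1.2
      rw [hxy] at this
      nlinarith
    · have := hinc y x hy.1.1 h hx.1.2
      rw [hxy] at this
      nlinarith
  -- a monotone extension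
  let F : ℝ → ℝ := fun x => f (max 1 (min x 2))
  have hFmono : Monotone F := by
    intro x y hxy
    have h' : max 1 (min x 2) ≤ max 1 (min y 2) := by gcongr
    have := hinc (max 1 (min x 2)) (max 1 (min y 2)) (le_max_left _ _) h' (by simp)
    have h2 : 0 ≤ c * (max 1 (min y 2) - max 1 (min x 2)) := mul_nonneg hcpos.le (by linarith)
    simp only [F]; linarith
  have hFf : Set.EqOn F f (E M) := by
    intro x hx
    simp only [F]
    rw [min_eq_left hx.1.2, max_eq_right hx.1.1]
  have himm : MeasurableSet (f '' E M) := by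
    rw [← hFf.image_eq]
    exact (hEm M).image_of_measurable_injOn hFmono.measurable (hinj.congr hFf.symm)
  have hpos : 0 < volume (f '' E M) := by
    have hlip : LipschitzOnWith (Real.toNNReal c⁻¹) (Function.invFunOn f (E M)) (f '' E M) := by
      apply LipschitzOnWith.of_dist_le_mul
      rintro _ ⟨x, hx, rfl⟩ _ ⟨y, hy, rfl⟩
      rw [hinj.leftInvOn_invFunOn hx, hinj.leftInvOn_invFunOn hy, Real.coe_toNNReal _ (by positivity),
        inv_mul_eq_div, le_div_iff₀ hcpos, Real.dist_eq, Real.dist_eq]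
      rcases le_total x y with h | h
      · have := hinc x y hx.1.1 h hy.1.2
        rw [abs_sub_comm, abs_of_nonneg (by linarith), abs_sub_comm]
        exact le_trans (by linarith) (le_abs_self _)
      · have := hinc y x hy.1.1 h hx.1.2
        rw [abs_of_nonneg (by linarith)]
        exact le_trans (by linarith) (le_abs_self _)
    have := hlip.hausdorffMeasure_image_le (d := 1) zero_le_one
    rw [hinj.leftInvOn_invFunOn.image_image, hausdorffMeasure_real] at this
    by_contra hcon
    have h0 : volume (f '' E M) = 0 := le_antisymm (not_lt.1 hcon) zero_le
    rw [h0, mul_zero] at this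
    exact absurd hM (not_lt.2 this)
  have hst := Measure.sub_mem_nhds_zero_of_addHaar_pos volume _ himm hpos
  obtain ⟨ε, hε, hball⟩ := Metric.mem_nhds_iff.1 hst
  have hb : ∀ u, 0 ≤ u → u < ε → |m u| ≤ 2 * M := by
    intro u hu hue
    have hu0 : u ∈ Metric.ball (0 : ℝ) ε := by simp [abs_of_nonneg hu, hue]
    obtain ⟨_, ⟨x, hx, rfl⟩, _, ⟨y, hy, rfl⟩, hxy⟩ := Set.mem_sub.1 (hball hu0)
    have h3 := hadd (f y) u (hf_pos y hy.1.1).le hu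
    rw [← hxy, add_sub_cancel, hxy] at h3
    have hx2 := hx.2
    have hy2 := hy.2
    simp only [Set.mem_ofPred_eq] at hx2 hy2
    have : m u = m (f x) - m (f y) := by linarith
    rw [this]
    calc _ ≤ |m (f x)| + |m (f y)| := abs_sub _ _
      _ ≤ _ := by linarith
  have hq : ∀ k n : ℕ, 0 < n → m (k / n) = 0 := by
    intro k n hn
    have a := additive_nsmul hadd n (t := 1 / n) (by positivity)
    rw [mul_one_div_cancel (by positivity), h1] at a
    have a' : m (1 / n) = 0 := by
      rcases mul_eq_zero.1 a.symm with h | h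
      · exact absurd h (by positivity)
      · exact h
    have b := additive_nsmul hadd k (t := 1 / n) (by positivity)
    rw [a', mul_zero, mul_one_div] at b
    exact b
  have hbd : ∀ u, 0 ≤ u → |m u| ≤ 2 * M := by
    intro u hu
    obtain ⟨n, hn⟩ := exists_nat_gt (1 / ε)
    have hn0 : 0 < n := by
      have : (0:ℝ) < n := lt_trans (by positivity) hn
      exact_mod_cast this
    have hn0' : (0:ℝ) < n := by exact_mod_cast hn0
    have hnu : 0 ≤ n * u := by positivity
    have c1 := Nat.floor_le hnu
    have c2 := Nat.lt_floor_add_one (n * u)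
    have d1 : (⌊n * u⌋₊ : ℝ) / n ≤ u := by rw [div_le_iff₀ hn0']; linarith
    have d2 : u - (⌊n * u⌋₊ : ℝ) / n < ε := by
      have : u < (⌊n * u⌋₊ : ℝ) / n + 1 / n := by
        rw [← add_div, lt_div_iff₀ hn0']; linarith
      have : 1 / (n:ℝ) < ε := by
        rw [div_lt_iff₀ hn0']; rw [div_lt_iff₀ hε] at hn; linarith
      linarith
    have h3 := hadd ((⌊n * u⌋₊ : ℝ) / n) (u - (⌊n * u⌋₊ : ℝ) / n) (by positivity) (by linarith)
    rw [hq _ _ hn0, zero_add, add_sub_cancel] at h3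
    rw [h3]
    exact hb _ (by linarith) d2
  by_contra hne
  have hp : 0 < |m t| := abs_pos.2 hne
  obtain ⟨n, hn⟩ := exists_nat_gt (2 * M / |m t|)
  rw [div_lt_iff₀ hp] at hn
  have := hbd (n * t) (by positivity)
  rw [additive_nsmul hadd n ht, abs_mul, Nat.abs_cast] at this
  linarith

section levy
variable {Ω : Type*} [MeasurableSpace Ω] {P : Measure Ω} [IsProbabilityMeasure P]
  {V : ℝ → Ω → ℝ} {σ : ℝ≥0}

lemma LevyH.indep2 (h : LevyH P V σ) {s t : ℝ} (hs : 0 ≤ s) (hst : s ≤ t) :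
    IndepFun (V s) (fun ω => V t ω - V s ω) P := by
  have h1 := h.hindep 2 ![0, s, t] (by
    intro i j hij
    fin_cases i <;> fin_cases j <;> simp_all <;> linarith) (by simp)
  have h2 := h1.indepFun (i := 0) (j := 1) (by decide)
  refine IndepFun.congr h2 ?_ ?_
  · filter_upwards [h.hV0] with ω hω
    simp [hω]
  · filter_upwards with ω
    simp

lemma LevyH.ident (h : LevyH P V σ) {s t : ℝ} (hs : 0 ≤ s) (hst : s ≤ t) :
    IdentDistrib (fun ω => V t ω - V s ω) (V (t - s)) P P :=
  ⟨((h.hVmeas t).sub (h.hVmeas s)).aemeasurable, (h.hVmeas _).aemeasurable, h.hstat s t hs hst⟩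

lemma LevyH.memLp_nat (h : LevyH P V σ) (n : ℕ) : MemLp (V n) 2 P := by
  induction n with
  | zero =>
    have : V ((0:ℕ):ℝ) =ᵐ[P] fun _ => (0:ℝ) := by
      filter_upwards [h.hV0] with ω hω
      simp [hω]
    exact (memLp_congr_ae this).2 (memLp_const 0)
  | succ n ih =>
    have h1 := h.ident (s := n) (t := (n + 1 : ℕ)) (by positivity) (by simp)
    have e : (((n + 1 : ℕ) : ℝ) - n) = 1 := by push_cast; ring
    rw [e] at h1
    have h2 := ih.add (h1.memLp_iff.2 h.hL2)
    convert! h2 using 1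
    ext ω; simp

lemma LevyH.memLp (h : LevyH P V σ) {t : ℝ} (ht : 0 ≤ t) : MemLp (V t) 2 P := by
  obtain ⟨n, hn⟩ := exists_nat_ge t
  refine memLp_left_of_add (h.hVmeas t) ((h.hVmeas n).sub (h.hVmeas t)) (h.indep2 ht hn) ?_
  simpa using h.memLp_nat n

lemma LevyH.integral_add (h : LevyH P V σ) (s t : ℝ) (hs : 0 ≤ s) (ht : 0 ≤ t) :
    ∫ ω, V (s + t) ω ∂P = ∫ ω, V s ω ∂P + ∫ ω, V t ω ∂P := by
  have h1 := (h.ident hs (t := s + t) (by linarith)).integral_eq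
  rw [add_sub_cancel_left, integral_sub ((h.memLp (by positivity)).integrable (by norm_num))
    ((h.memLp hs).integrable (by norm_num))] at h1
  linarith

lemma LevyH.var_add (h : LevyH P V σ) (s t : ℝ) (hs : 0 ≤ s) (ht : 0 ≤ t) :
    variance (V (s + t)) P = variance (V s) P + variance (V t) P := by
  have h0 := h.ident hs (t := s + t) (by linarith)
  have h1 := h0.variance_eq
  rw [add_sub_cancel_left] at h0 h1
  rw [← h1, ← IndepFun.variance_add (h.memLp hs) (h0.memLp_iff.2 (h.memLp ht))
    (h.indep2 hs (by linarith))]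
  congr 1
  ext ω; simp

lemma LevyH.mean (h : LevyH P V σ) (f : ℝ → ℝ) (hf_pos : ∀ x, 1 ≤ x → 0 < f x)
    (β : ℝ) (hβ : 0 < β)
    (hB : ∀ x y : ℝ, 1 ≤ x → x ≤ y → f x / x ^ β ≤ f y / y ^ β)
    (hjoint : Measurable (Function.uncurry fun (s : ℝ) (ω : Ω) => V (f s) ω)) {t : ℝ}
    (ht : 0 ≤ t) : ∫ ω, V t ω ∂P = 0 :=
  additive_zero (m := fun t => ∫ ω, V t ω ∂P) h.integral_add h.hcent f hf_pos β hβ hB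
    (hjoint.stronglyMeasurable.integral_prod_right).measurable ht

lemma LevyH.var_one (h : LevyH P V σ) : variance (V 1) P = (σ : ℝ) ^ 2 := by
  rw [variance_of_integral_eq_zero h.hL2.aestronglyMeasurable.aemeasurable h.hcent, h.hvar]

lemma LevyH.var (h : LevyH P V σ) {t : ℝ} (ht : 0 ≤ t) : variance (V t) P = t * (σ : ℝ) ^ 2 := by
  rw [← h.var_one]
  exact additive_nonneg (v := fun t => variance (V t) P) h.var_add
    (fun t _ => variance_nonneg _ _) ht

lemma LevyH.abs_le (h : LevyH P V σ) (hm : ∀ t, 0 ≤ t → ∫ ω, V t ω ∂P = 0) {t : ℝ}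
    (ht : 0 ≤ t) : ∫ ω, |V t ω| ∂P ≤ σ * √t := by
  have h1 : ∫ ω, (V t ω) ^ 2 ∂P = t * (σ : ℝ) ^ 2 := by
    rw [← variance_of_integral_eq_zero (h.hVmeas t).aemeasurable (hm t ht), h.var ht]
  have h2 := variance_nonneg (fun ω => |V t ω|) P
  have hL : MemLp (fun ω => |V t ω|) 2 P := (h.memLp ht).abs
  rw [variance_eq_sub hL] at h2
  simp only [Pi.pow_apply, sq_abs] at h2
  rw [h1] at h2
  refine (le_abs_self _).trans (abs_le_of_sq_le_sq ?_ (by positivity))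
  rw [mul_pow, Real.sq_sqrt ht]
  linarith

lemma LevyH.abs_sub_le (h : LevyH P V σ) (hm : ∀ t, 0 ≤ t → ∫ ω, V t ω ∂P = 0) {s t : ℝ}
    (hs : 0 ≤ s) (hst : s ≤ t) : ∫ ω, |V t ω - V s ω| ∂P ≤ σ * √(t - s) := by
  have := ((h.ident hs hst).comp (u := fun x => |x|) (by fun_prop)).integral_eq
  simp only [Function.comp_def] at this
  rw [this]
  exact h.abs_le hm (by linarith)

end levy

section clt
variable {Ω : Type*} [MeasurableSpace Ω] {P : Measure Ω} [IsProbabilityMeasure P]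
  {V : ℝ → Ω → ℝ} {σ : ℝ≥0}

lemma LevyH.iIndep_nat (h : LevyH P V σ) :
    iIndepFun (fun (i : ℕ) ω => V ((i : ℝ) + 1) ω - V i ω) P := by
  rw [iIndepFun_iff_finset]
  intro s
  obtain ⟨k, hk⟩ := s.exists_nat_subset_range
  have h1 := h.hindep k (fun i => (i : ℕ)) (fun i j hij => by simpa using hij) (by simp)
  have h2 := h1.precomp (g := fun i : s => (⟨i.1, Finset.mem_range.1 (hk i.2)⟩ : Fin k))
    (fun i j hij => by ext; simpa using hij)
  convert! h2 using 2
  simp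

lemma LevyH.clt_nat (h : LevyH P V σ) (g : BoundedContinuousFunction ℝ ℝ) :
    Tendsto (fun n : ℕ => ∫ ω, g (V n ω / √n) ∂P) atTop
      (𝓝 (∫ y, g y ∂(gaussianReal 0 (σ ^ 2)))) := by
  set X : ℕ → Ω → ℝ := fun i ω => V ((i : ℝ) + 1) ω - V i ω with hX
  have hid : ∀ i, IdentDistrib (X i) (V 1) P P := fun i => by
    simpa using h.ident (s := i) (t := i + 1) (by positivity) (by linarith)
  have hv : variance (X 0) P = (σ:ℝ) ^ 2 := by rw [(hid 0).variance_eq, h.var_one]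
  have hmean : ∫ ω, X 0 ω ∂P = 0 := by rw [(hid 0).integral_eq, h.hcent]
  have hY : HasLaw (id : ℝ → ℝ) (gaussianReal 0 (variance (X 0) P).toNNReal)
      (gaussianReal 0 (σ ^ 2)) := by
    have : (variance (X 0) P).toNNReal = σ ^ 2 := by
      rw [hv]; ext; simp
    rw [this]
    exact ⟨aemeasurable_id, Measure.map_id⟩
  have hT := tendstoInDistribution_inv_sqrt_mul_sum_sub hY ((hid 0).memLp_iff.2 h.hL2)
    h.iIndep_nat (fun i => (hid i).trans (hid 0).symm)
  have h3 := (ProbabilityMeasure.tendsto_iff_forall_integral_tendsto.1 hT.tendsto) g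
  simp only [ProbabilityMeasure.coe_mk, Measure.map_id] at h3
  refine h3.congr fun n => ?_
  rw [integral_map (hT.forall_aemeasurable n) (by fun_prop)]
  apply integral_congr_ae
  filter_upwards [h.hV0] with ω hω
  have e : ∑ k ∈ Finset.range n, X k ω = V n ω := by
    have := Finset.sum_range_sub (fun i : ℕ => V i ω) n
    simp only [hX]
    push_cast at this
    rw [this]; simp [hω]
  rw [hmean, e]
  congr 1
  ring

lemma LevyH.clt (h : LevyH P V σ) (hm : ∀ t, 0 ≤ t → ∫ ω, V t ω ∂P = 0)
    (g : BoundedContinuousFunction ℝ ℝ) (L : ℝ) (hL : ∀ x y, |g x - g y| ≤ L * |x - y|) :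
    Tendsto (fun t : ℝ => ∫ ω, g (V t ω / √t) ∂P) atTop
      (𝓝 (∫ y, g y ∂(gaussianReal 0 (σ ^ 2)))) := by
  have hL0 : 0 ≤ L := by
    have := hL 0 1
    have h2 := abs_nonneg (g 0 - g 1)
    norm_num at this
    linarith
  have h1 := (h.clt_nat g).comp (tendsto_nat_floor_atTop (α := ℝ))
  have h2 : Tendsto (fun t : ℝ => L * (σ * 1 / √t + σ * (1 / √t))) atTop (𝓝 0) := by
    have : Tendsto (fun t : ℝ => 1 / √t) atTop (𝓝 0) := by
      simp only [one_div]
      exact tendsto_inv_atTop_zero.comp Real.tendsto_sqrt_atTop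
    have := ((this.const_mul (σ:ℝ)).add (this.const_mul (σ:ℝ))).const_mul L
    simpa [div_eq_mul_inv] using this
  have hgi : ∀ u v : ℝ, Integrable (fun ω => g (V u ω / v)) P := fun u v =>
    Integrable.of_bound (C := ‖g‖)
      (g.continuous.measurable.comp ((h.hVmeas u).div_const _)).aestronglyMeasurable
      (.of_forall fun ω => g.norm_coe_le_norm _)
  have hint : ∀ t, 0 ≤ t → Integrable (V t) P := fun t ht => (h.memLp ht).integrable (by norm_num)
  have key : ∀ᶠ t : ℝ in atTop, |∫ ω, g (V t ω / √t) ∂P - ∫ ω, g (V ⌊t⌋₊ ω / √⌊t⌋₊) ∂P|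
      ≤ L * (σ * 1 / √t + σ * (1 / √t)) := by
    filter_upwards [eventually_ge_atTop 1] with t ht
    have ht0 : 0 ≤ t := by linarith
    set n : ℝ := (⌊t⌋₊ : ℝ) with hn
    have hnt : n ≤ t := Nat.floor_le ht0
    have htn : t < n + 1 := Nat.lt_floor_add_one t
    have hn1 : 1 ≤ n := by
      have := Nat.le_floor (α := ℝ) (n := 1) (a := t) (by simpa using ht)
      rw [hn]; exact_mod_cast this
    have hn0 : 0 ≤ n := by linarith
    have hsn : 0 < √n := Real.sqrt_pos.2 (by linarith)
    have hst : 0 < √t := Real.sqrt_pos.2 (by linarith)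
    have hsnt : √n ≤ √t := Real.sqrt_le_sqrt hnt
    have q1 := Real.sq_sqrt hn0
    have q2 := Real.sq_sqrt ht0
    have hd0 : 0 ≤ 1 / √n - 1 / √t := sub_nonneg.2 (one_div_le_one_div_of_le hsn hsnt)
    rw [← integral_sub (hgi _ _) (hgi _ _)]
    calc |∫ ω, (g (V t ω / √t) - g (V n ω / √n)) ∂P|
        ≤ ∫ ω, |g (V t ω / √t) - g (V n ω / √n)| ∂P := abs_integral_le_integral_abs
      _ ≤ ∫ ω, L * (|V t ω - V n ω| / √t + |V n ω| * (1 / √n - 1 / √t)) ∂P := by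
          apply integral_mono ((hgi _ _).sub (hgi _ _)).abs
          · exact ((((hint t ht0).sub (hint n hn0)).abs.div_const _).add
              ((hint n hn0).abs.mul_const _)).const_mul _
          · intro ω
            dsimp only
            refine (hL _ _).trans (mul_le_mul_of_nonneg_left ?_ hL0)
            have e : V t ω / √t - V n ω / √n
              = (V t ω - V n ω) / √t - V n ω * (1 / √n - 1 / √t) := by ring
            rw [e]
            refine (abs_sub _ _).trans ?_
            rw [abs_div, abs_mul, abs_of_pos hst, abs_of_nonneg hd0]
      _ = L * ((∫ ω, |V t ω - V n ω| ∂P) / √t + (∫ ω, |V n ω| ∂P) * (1 / √n - 1 / √t)) := by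
          rw [integral_const_mul, MeasureTheory.integral_add, integral_div, integral_mul_const]
          · exact (((hint t ht0).sub (hint n hn0)).abs.div_const _)
          · exact ((hint n hn0).abs.mul_const _)
      _ ≤ L * (σ * √(t - n) / √t + σ * √n * (1 / √n - 1 / √t)) := by
          gcongr
          · exact h.abs_sub_le hm hn0 hnt
          · exact h.abs_le hm hn0
      _ ≤ _ := by
          have e1 : √(t - n) ≤ 1 := by
            rw [Real.sqrt_le_left (by norm_num)]; linarith
          have e2 : √n * (1 / √n - 1 / √t) ≤ 1 / √t := by
            have : √n * (1 / √n - 1 / √t) = (√t - √n) / √t := by field_simp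
            rw [this]
            gcongr
            nlinarith
          rw [mul_assoc (σ : ℝ)]
          gcongr
  have h3 : Tendsto (fun t : ℝ => ∫ ω, g (V t ω / √t) ∂P - ∫ ω, g (V ⌊t⌋₊ ω / √⌊t⌋₊) ∂P) atTop
      (𝓝 0) := squeeze_zero_norm' key h2
  have := h3.add h1
  simpa [Function.comp_def] using this

lemma LevyH.cov (h : LevyH P V σ) (hm : ∀ t, 0 ≤ t → ∫ ω, V t ω ∂P = 0)
    (g : BoundedContinuousFunction ℝ ℝ) (L : ℝ) (hL : ∀ x y, |g x - g y| ≤ L * |x - y|)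
    {s t : ℝ} (hs : 0 < s) (hst : s ≤ t) :
    |∫ ω, (g (V s ω / √s) - ∫ ω', g (V s ω' / √s) ∂P) *
      (g (V t ω / √t) - ∫ ω', g (V t ω' / √t) ∂P) ∂P| ≤
      2 * ‖g‖ * L * σ * √(s / t) := by
  have hL0 : 0 ≤ L := by
    have := hL 0 1
    have h2 := abs_nonneg (g 0 - g 1)
    norm_num at this
    linarith
  have ht : 0 < t := by linarith
  have hgm : ∀ {Y : Ω → ℝ}, Measurable Y → Measurable (fun ω => g (Y ω)) := fun hY =>
    g.continuous.measurable.comp hY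
  have hgi : ∀ {Y : Ω → ℝ}, Measurable Y → Integrable (fun ω => g (Y ω)) P := fun hY =>
    Integrable.of_bound (C := ‖g‖) (hgm hY).aestronglyMeasurable
      (.of_forall fun ω => g.norm_coe_le_norm _)
  set X : Ω → ℝ := fun ω => V s ω / √s with hX
  set Y : Ω → ℝ := fun ω => V t ω / √t with hY
  set W : Ω → ℝ := fun ω => (V t ω - V s ω) / √t with hW
  have mX : Measurable X := (h.hVmeas s).div_const _
  have mY : Measurable Y := (h.hVmeas t).div_const _
  have mW : Measurable W := ((h.hVmeas t).sub (h.hVmeas s)).div_const _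
  set a := ∫ ω, g (X ω) ∂P with ha
  set b := ∫ ω, g (Y ω) ∂P with hb
  have hξi : Integrable (fun ω => g (X ω) - a) P := (hgi mX).sub (integrable_const _)
  have hξ0 : ∫ ω, (g (X ω) - a) ∂P = 0 := by
    rw [integral_sub (hgi mX) (integrable_const _)]; simp [ha]
  have ha' : |a| ≤ ‖g‖ := by
    have := norm_integral_le_of_norm_le_const (μ := P) (f := fun ω => g (X ω)) (C := ‖g‖)
      (.of_forall fun ω => g.norm_coe_le_norm _)
    simpa using this
  have hξb : ∀ ω, |g (X ω) - a| ≤ 2 * ‖g‖ := fun ω => by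
    have := g.norm_coe_le_norm (X ω)
    rw [Real.norm_eq_abs] at this
    linarith [abs_sub (g (X ω)) a]
  have hind : IndepFun (fun ω => g (X ω) - a) (fun ω => g (W ω)) P := by
    have := (h.indep2 hs.le hst).comp (φ := fun x => g (x / √s) - a) (ψ := fun x => g (x / √t))
      (by fun_prop) (by fun_prop)
    exact this
  have hz : ∫ ω, (g (X ω) - a) * g (W ω) ∂P = 0 := by
    rw [hind.integral_fun_mul_eq_mul_integral hξi.aestronglyMeasurable (hgi mW).aestronglyMeasurable, hξ0, zero_mul]
  have hbi : ∀ {F : Ω → ℝ}, Integrable F P → Integrable (fun ω => (g (X ω) - a) * F ω) P :=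
    fun hF => hF.bdd_mul (c := 2 * ‖g‖) hξi.aestronglyMeasurable (.of_forall hξb)
  have e : ∫ ω, (g (X ω) - a) * (g (Y ω) - b) ∂P
      = ∫ ω, (g (X ω) - a) * (g (Y ω) - g (W ω)) ∂P := by
    simp only [mul_sub]
    rw [integral_sub (hbi (hgi mY)) (hbi (integrable_const _)),
      integral_sub (hbi (hgi mY)) (hbi (hgi mW)), hz, integral_mul_const, hξ0, zero_mul]
  rw [e]
  have hint : Integrable (V s) P := (h.memLp hs.le).integrable (by norm_num)
  have hst' : 0 < √t := Real.sqrt_pos.2 ht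
  calc |∫ ω, (g (X ω) - a) * (g (Y ω) - g (W ω)) ∂P|
      ≤ ∫ ω, |(g (X ω) - a) * (g (Y ω) - g (W ω))| ∂P := abs_integral_le_integral_abs
    _ ≤ ∫ ω, 2 * ‖g‖ * (L * (|V s ω| / √t)) ∂P := by
        apply integral_mono (hbi ((hgi mY).sub (hgi mW))).abs
        · exact ((hint.abs.div_const _).const_mul _).const_mul _
        · intro ω
          dsimp only
          rw [abs_mul]
          gcongr
          · exact hξb ω
          · refine (hL _ _).trans (le_of_eq ?_)
            congr 1
            have e9 : |V s ω| / √t = |V s ω / √t| := by rw [abs_div, abs_of_pos hst']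
            rw [e9]
            congr 1
            simp only [hY, hW]; ring
    _ = 2 * ‖g‖ * (L * ((∫ ω, |V s ω| ∂P) / √t)) := by
        rw [integral_const_mul, integral_const_mul, integral_div]
    _ ≤ 2 * ‖g‖ * (L * ((σ * √s) / √t)) := by
        gcongr
        exact h.abs_le hm hs.le
    _ = _ := by rw [Real.sqrt_div hs.le]; ring

end clt

lemma second_moment {Ω : Type*} [MeasurableSpace Ω] {P : Measure Ω} [IsProbabilityMeasure P]
    (ν : Measure ℝ) [IsFiniteMeasure ν] (F : ℝ → Ω → ℝ) (hF : Measurable (Function.uncurry F))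
    (B : ℝ) (hB : ∀ s ω, |F s ω| ≤ B) :
    ∫ ω, (∫ s, F s ω ∂ν) ^ 2 ∂P = ∫ t, ∫ s, (∫ ω, F s ω * F t ω ∂P) ∂ν ∂ν := by
  have hB0 : ∀ s t ω, ‖F s ω * F t ω‖ ≤ B * B := fun s t ω => by
    rw [norm_mul]
    exact mul_le_mul (hB _ _) (hB _ _) (norm_nonneg _) ((abs_nonneg _).trans (hB s ω))
  have m2 : Measurable (fun p : (Ω × ℝ) × ℝ => F p.2 p.1.1 * F p.1.2 p.1.1) := by
    have a1 : Measurable (fun p : (Ω × ℝ) × ℝ => F p.2 p.1.1) :=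
      hF.comp (f := fun p : (Ω × ℝ) × ℝ => (p.2, p.1.1)) (by fun_prop)
    have a2 : Measurable (fun p : (Ω × ℝ) × ℝ => F p.1.2 p.1.1) :=
      hF.comp (f := fun p : (Ω × ℝ) × ℝ => (p.1.2, p.1.1)) (by fun_prop)
    exact a1.mul a2
  have e1 : ∀ ω, (∫ s, F s ω ∂ν) ^ 2 = ∫ t, ∫ s, F s ω * F t ω ∂ν ∂ν := fun ω => by
    simp_rw [integral_mul_const, integral_const_mul]
    rw [sq]
  simp_rw [e1]
  rw [integral_integral_swap]
  · congr 1
    ext t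
    rw [integral_integral_swap]
    refine Integrable.of_bound (C := B * B) ?_ (.of_forall fun p => hB0 _ _ _)
    have : Measurable (fun p : Ω × ℝ => F p.2 p.1 * F t p.1) :=
      m2.comp (f := fun p : Ω × ℝ => ((p.1, t), p.2)) (by fun_prop)
    exact this.aestronglyMeasurable
  · refine Integrable.of_bound (C := B * B * ν.real Set.univ) ?_ (.of_forall fun p => ?_)
    · exact (m2.stronglyMeasurable.integral_prod_right').aestronglyMeasurable
    · exact norm_integral_le_of_norm_le_const (.of_forall fun s => hB0 _ _ _)

lemma kernel_bound {γ B t S : ℝ} (hγ : 0 < γ) (hB0 : 0 ≤ B) (ht : 1 ≤ t) (hS : 1 ≤ S) (h : ℝ → ℝ)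
    (h0 : ∀ s, 0 ≤ h s) (hi : ∀ a b, IntervalIntegrable h volume a b)
    (h1 : ∀ s, 1 ≤ s → s ≤ t → h s ≤ B * t ^ (-γ) * s ^ (γ - 1))
    (h2 : ∀ s, t ≤ s → h s ≤ B * t ^ γ * s ^ (-γ - 1)) :
    ∫ s in (1:ℝ)..S, h s ≤ 2 * B / γ := by
  have ht0 : 0 < t := by linarith
  set T := max S t
  have hT : t ≤ T := le_max_right _ _
  have hT0 : 0 < T := by linarith
  have a1 : ∫ s in (1:ℝ)..S, h s ≤ ∫ s in (1:ℝ)..T, h s :=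
    intervalIntegral.integral_mono_interval le_rfl hS (le_max_left _ _)
      (.of_forall fun s => h0 s) (hi _ _)
  have i1 : IntervalIntegrable (fun s : ℝ => B * t ^ (-γ) * s ^ (γ - 1)) volume 1 t :=
    (intervalIntegral.intervalIntegrable_rpow' (by linarith)).const_mul _
  have i2 : IntervalIntegrable (fun s : ℝ => B * t ^ γ * s ^ (-γ - 1)) volume t T :=
    (intervalIntegral.intervalIntegrable_rpow (Or.inr (by
      rw [Set.uIcc_of_le hT]; intro h; linarith [h.1]))).const_mul _
  have a2 : ∫ s in (1:ℝ)..t, h s ≤ B / γ := by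
    refine (intervalIntegral.integral_mono_on ht (hi _ _) i1 (fun s hs => h1 s hs.1 hs.2)).trans ?_
    rw [intervalIntegral.integral_const_mul, integral_rpow (Or.inl (by linarith))]
    simp only [sub_add_cancel, Real.one_rpow]
    have : B * t ^ (-γ) * ((t ^ γ - 1) / γ) = B / γ * (t ^ (-γ) * t ^ γ - t ^ (-γ)) := by ring
    rw [this, ← Real.rpow_add ht0, neg_add_cancel, Real.rpow_zero]
    have : 0 ≤ t ^ (-γ) := by positivity
    have : 0 ≤ B / γ := by positivity
    nlinarith
  have a3 : ∫ s in t..T, h s ≤ B / γ := by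
    refine (intervalIntegral.integral_mono_on hT (hi _ _) i2 (fun s hs => h2 s hs.1)).trans ?_
    rw [intervalIntegral.integral_const_mul, integral_rpow (Or.inr ⟨by linarith, by
      rw [Set.uIcc_of_le hT]; intro h; linarith [h.1]⟩)]
    simp only [sub_add_cancel]
    have : B * t ^ γ * ((T ^ (-γ) - t ^ (-γ)) / -γ) = B / γ * (t ^ γ * t ^ (-γ) - t ^ γ * T ^ (-γ)) := by
      field_simp; ring
    rw [this, ← Real.rpow_add ht0, add_neg_cancel, Real.rpow_zero]
    have : 0 ≤ t ^ γ * T ^ (-γ) := by positivity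
    have : 0 ≤ B / γ := by positivity
    nlinarith
  rw [← intervalIntegral.integral_add_adjacent_intervals (hi 1 t) (hi t T)] at a1
  have : 2 * B / γ = B / γ + B / γ := by ring
  linarith

lemma interp {T D : ℝ → ℝ} {M : ℝ} (hM : 0 ≤ M)
    (hlip : ∀ S S', 1 ≤ S → 1 ≤ S' → |T S - T S'| ≤ M * |D S - D S'|)
    (hD : Tendsto D atTop atTop) (s : ℕ → ℝ) (hs1 : ∀ n, 1 ≤ s n) (hsD : ∀ n, D (s n) = (n:ℝ) ^ 2)
    (hs : Tendsto (fun n => T (s n) / D (s n)) atTop (𝓝 0)) :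
    Tendsto (fun S => T S / D S) atTop (𝓝 0) := by
  let k : ℝ → ℕ := fun S => ⌊√(D S)⌋₊
  have hk : Tendsto k atTop atTop :=
    tendsto_nat_floor_atTop.comp (Real.tendsto_sqrt_atTop.comp hD)
  have hb : Tendsto (fun n : ℕ => |T (s n) / D (s n)| + M * (3 / n)) atTop (𝓝 0) := by
    have h2 : Tendsto (fun n : ℕ => (3:ℝ) / n) atTop (𝓝 0) := tendsto_const_div_atTop_nhds_zero_nat 3
    simpa using hs.abs.add (h2.const_mul M)
  refine squeeze_zero_norm' ?_ (hb.comp hk)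
  filter_upwards [eventually_ge_atTop 1, hD.eventually_ge_atTop 1] with S hS hDS
  have hq := Real.sq_sqrt (show 0 ≤ D S by linarith)
  have c1 : (k S : ℝ) ≤ √(D S) := Nat.floor_le (Real.sqrt_nonneg _)
  have c2 : √(D S) < k S + 1 := Nat.lt_floor_add_one _
  have hk1 : (1:ℝ) ≤ k S := by
    have : 1 ≤ k S := Nat.le_floor (by simpa using hDS)
    exact_mod_cast this
  simp only [Function.comp]
  generalize k S = n at *
  have hl := hlip S (s n) hS (hs1 n)
  rw [hsD] at hl ⊢
  have hn0 : (0:ℝ) < n := by linarith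
  have d1 : (n:ℝ)^2 ≤ D S := by nlinarith
  have d2 : D S - (n:ℝ)^2 ≤ 3 * n := by nlinarith [Real.sqrt_nonneg (D S)]
  rw [abs_of_nonneg (show 0 ≤ D S - (n:ℝ)^2 by linarith)] at hl
  have d3 : |T S| ≤ |T (s n)| + M * (3 * n) := by
    have : |T S| ≤ |T (s n)| + |T S - T (s n)| := by
      have := abs_add_le (T (s n)) (T S - T (s n))
      rwa [add_sub_cancel] at this
    nlinarith
  rw [Real.norm_eq_abs, abs_div, abs_div, abs_of_pos (show 0 < D S by linarith), abs_of_pos (show 0 < (n:ℝ)^2 by positivity)]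
  calc |T S| / D S ≤ |T S| / (n:ℝ)^2 := by gcongr
    _ ≤ (|T (s n)| + M * (3 * n)) / (n:ℝ)^2 := by gcongr
    _ = _ := by field_simp

lemma ii_of_bound {h : ℝ → ℝ} (hm : Measurable h) (C : ℝ) (hC : ∀ s, ‖h s‖ ≤ C) (a b : ℝ) :
    IntervalIntegrable h volume a b := by
  constructor <;> exact Integrable.of_bound (C := C) hm.aestronglyMeasurable (.of_forall hC)

lemma as_avg {Ω : Type*} [MeasurableSpace Ω] {P : Measure Ω} [IsProbabilityMeasure P]
    (ξ : ℝ → Ω → ℝ) (hξ : Measurable (Function.uncurry ξ)) (M : ℝ) (hM : ∀ s ω, |ξ s ω| ≤ M)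
    (A γ C : ℝ) (hA : 0 ≤ A) (hγ : 0 < γ) (hC : 0 ≤ C)
    (hcov : ∀ s t, 1 ≤ s → s ≤ t → |∫ ω, ξ s ω * ξ t ω ∂P| ≤ A * (s / t) ^ γ)
    (d : ℝ → ℝ) (hd : Antitone d) (hd0 : ∀ s, 0 < d s) (hd1 : ∀ s, d s ≤ d 1)
    (hdC : ∀ s, 1 ≤ s → d s ≤ C / s)
    (hdiv : Tendsto (fun S : ℝ => ∫ s in (1 : ℝ)..S, d s) atTop atTop) :
    ∀ᵐ ω ∂P, Tendsto (fun S : ℝ => (∫ s in (1 : ℝ)..S, ξ s ω * d s) / ∫ s in (1 : ℝ)..S, d s)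
      atTop (𝓝 0) := by
  have hΩ : Nonempty Ω := nonempty_of_isProbabilityMeasure P
  have hM0 : 0 ≤ M := (abs_nonneg _).trans (hM 0 hΩ.some)
  have hdi : ∀ a b, IntervalIntegrable d volume a b := fun a b => hd.intervalIntegrable
  set D : ℝ → ℝ := fun S => ∫ s in (1 : ℝ)..S, d s with hD
  have hDc : Continuous D := intervalIntegral.continuous_primitive hdi 1
  let F : ℝ → Ω → ℝ := fun s ω => ξ s ω * d s
  have hFm : Measurable (Function.uncurry F) := hξ.mul (hd.measurable.comp measurable_fst)
  have hFB : ∀ s ω, |F s ω| ≤ M * d 1 := fun s ω => by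
    simp only [F]
    rw [abs_mul, abs_of_pos (hd0 s)]
    exact mul_le_mul (hM _ _) (hd1 s) (hd0 s).le hM0
  have hFi : ∀ ω a b, IntervalIntegrable (fun s => F s ω) volume a b := fun ω a b => by
    exact ii_of_bound (hFm.comp (by fun_prop : Measurable fun s => (s, ω))) (M * d 1)
      (fun s => hFB s ω) a b
  -- second moment
  have hmom : ∀ S, 1 ≤ S → ∫ ω, (∫ s in (1:ℝ)..S, F s ω) ^ 2 ∂P ≤ 2 * (A * C) / γ * D S := by
    intro S hS
    have h1 := second_moment (P := P) (volume.restrict (Set.Ioc 1 S)) F hFm (M * d 1) hFB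
    simp only [← intervalIntegral.integral_of_le hS] at h1
    rw [h1, hD, ← intervalIntegral.integral_const_mul]
    have hcm : Measurable (fun p : ℝ × ℝ => ∫ ω, F p.2 ω * F p.1 ω ∂P) := by
      have a1 : Measurable (fun p : (ℝ × ℝ) × Ω => F p.1.2 p.2) :=
        hFm.comp (f := fun p : (ℝ × ℝ) × Ω => (p.1.2, p.2)) (by fun_prop)
      have a2 : Measurable (fun p : (ℝ × ℝ) × Ω => F p.1.1 p.2) :=
        hFm.comp (f := fun p : (ℝ × ℝ) × Ω => (p.1.1, p.2)) (by fun_prop)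
      exact (a1.mul a2).stronglyMeasurable.integral_prod_right'.measurable
    have hB0 : ∀ s t ω, ‖F s ω * F t ω‖ ≤ (M * d 1) * (M * d 1) := fun s t ω => by
      rw [norm_mul]
      exact mul_le_mul (hFB _ _) (hFB _ _) (norm_nonneg _) ((abs_nonneg _).trans (hFB s ω))
    have hcb : ∀ s t, ‖∫ ω, F s ω * F t ω ∂P‖ ≤ (M * d 1) * (M * d 1) := fun s t => by
      have := norm_integral_le_of_norm_le_const (μ := P) (f := fun ω => F s ω * F t ω)
        (.of_forall fun ω => hB0 s t ω)
      simpa using this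
    have hci : ∀ t a b, IntervalIntegrable (fun s => ∫ ω, F s ω * F t ω ∂P) volume a b :=
      fun t a b => by
      exact ii_of_bound (hcm.comp (by fun_prop : Measurable fun s : ℝ => (t, s)))
        ((M * d 1) * (M * d 1)) (fun s => hcb s t) a b
    have hri : ∀ t a b, IntervalIntegrable (fun s => ∫ ω, ξ s ω * ξ t ω * d s ∂P) volume a b := by
      intro t a b
      have := (hci t a b).mul_const (d t)⁻¹
      refine this.congr (fun s _ => ?_)
      rw [← integral_mul_const]
      congr 1
      ext ω
      simp only [F]
      have := (hd0 t).ne'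
      field_simp
    refine intervalIntegral.integral_mono_on hS ?_ ((hdi _ _).const_mul _) fun t ht => ?_
    · refine ii_of_bound ?_ ((M * d 1) * (M * d 1) * |S - 1|) (fun t => ?_) _ _
      · simp only [intervalIntegral.integral_of_le hS]
        exact (hcm.stronglyMeasurable.integral_prod_right').measurable
      · exact intervalIntegral.norm_integral_le_of_norm_le_const fun s _ => hcb s t
    · have e : ∀ s, ∫ ω, F s ω * F t ω ∂P = (∫ ω, ξ s ω * ξ t ω * d s ∂P) * d t := fun s => by
        rw [← integral_mul_const]
        congr 1
        ext ω
        simp only [F]; ring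
      simp only [e]
      rw [intervalIntegral.integral_mul_const]
      refine mul_le_mul_of_nonneg_right ?_ (hd0 t).le
      refine (le_abs_self _).trans ((intervalIntegral.abs_integral_le_integral_abs hS).trans ?_)
      have ht0 : 0 < t := by linarith [ht.1]
      refine kernel_bound hγ (by positivity) ht.1 hS _ (fun s => abs_nonneg _)
        (fun a b => (hri t a b).abs) ?_ ?_
      · intro s hs hst
        have hs0 : 0 < s := by linarith
        rw [integral_mul_const, abs_mul, abs_of_pos (hd0 s)]
        calc _ ≤ A * (s / t) ^ γ * (C / s) := by
              gcongr
              · exact (hd0 s).le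
              · exact hcov s t hs hst
              · exact hdC s hs
          _ = _ := by
              rw [Real.div_rpow hs0.le ht0.le, Real.rpow_neg ht0.le, Real.rpow_sub_one hs0.ne']
              field_simp
      · intro s hst
        have hs0 : 0 < s := by linarith
        rw [integral_mul_const, abs_mul, abs_of_pos (hd0 s)]
        calc _ ≤ A * (t / s) ^ γ * (C / s) := by
              gcongr
              · exact (hd0 s).le
              · have := hcov t s ht.1 hst
                simpa only [mul_comm] using this
              · exact hdC s (by linarith [ht.1])
          _ = _ := by
              rw [Real.div_rpow ht0.le hs0.le, Real.rpow_sub_one hs0.ne', Real.rpow_neg hs0.le]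
              field_simp
  -- subsequence
  have hsub : ∀ n : ℕ, ∃ S, 1 ≤ S ∧ D S = (n:ℝ) ^ 2 := by
    intro n
    obtain ⟨T, hT⟩ := ((eventually_ge_atTop 1).and (hdiv.eventually_ge_atTop ((n:ℝ)^2))).exists
    have := intermediate_value_Icc hT.1 hDc.continuousOn
    obtain ⟨S, hS, hS2⟩ := this (show (n:ℝ)^2 ∈ Set.Icc (D 1) (D T) from
      ⟨by simp [hD], hT.2⟩)
    exact ⟨S, hS.1, hS2⟩
  choose S hS1 hSD using hsub
  set Y : ℕ → Ω → ℝ := fun n ω => ((∫ s in (1:ℝ)..S n, F s ω) / D (S n)) ^ 2 with hY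
  have hTm : ∀ n, Measurable (fun ω => ∫ s in (1:ℝ)..S n, F s ω) := fun n => by
    simp only [intervalIntegral.integral_of_le (hS1 n)]
    exact (hFm.comp measurable_swap).stronglyMeasurable.integral_prod_right'.measurable
  have hYm : ∀ n, Measurable (Y n) := fun n => ((hTm n).div_const _).pow_const _
  have hYi : ∀ n, Integrable (Y n) P := fun n => by
    refine Integrable.of_bound (C := ((M * d 1) * |S n - 1| / |D (S n)|) ^ 2)
      (hYm n).aestronglyMeasurable (.of_forall fun ω => ?_)
    simp only [hY]
    rw [norm_pow, norm_div, Real.norm_eq_abs (D (S n))]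
    gcongr
    exact intervalIntegral.norm_integral_le_of_norm_le_const fun s _ => hFB s ω
  have hYb : ∀ n, ∫ ω, Y n ω ∂P ≤ 2 * (A * C) / γ * (1 / (n:ℝ) ^ 2) := fun n => by
    simp only [hY, div_pow]
    rw [integral_div]
    have := hmom (S n) (hS1 n)
    rw [hSD] at this ⊢
    rcases Nat.eq_zero_or_pos n with h | h
    · simp [h]
    · have hn : (0:ℝ) < n := by exact_mod_cast h
      rw [div_le_iff₀ (by positivity)]
      refine this.trans (le_of_eq ?_)
      field_simp
  have hsum : ∑' n, ∫⁻ ω, ENNReal.ofReal (Y n ω) ∂P ≠ ⊤ := by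
    have hs : Summable (fun n : ℕ => 2 * (A * C) / γ * (1 / (n:ℝ) ^ 2)) :=
      (Real.summable_one_div_nat_pow.2 one_lt_two).mul_left _
    refine ne_top_of_le_ne_top hs.tsum_ofReal_ne_top (ENNReal.tsum_le_tsum fun n => ?_)
    rw [← ofReal_integral_eq_lintegral_ofReal (hYi n) (.of_forall fun ω => sq_nonneg _)]
    exact ENNReal.ofReal_le_ofReal (hYb n)
  rw [← lintegral_tsum (fun n => (hYm n).ennreal_ofReal.aemeasurable)] at hsum
  have hae := ae_lt_top (Measurable.tsum fun n => (hYm n).ennreal_ofReal) hsum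
  filter_upwards [hae] with ω hω
  have h0 := ENNReal.tendsto_atTop_zero_of_tsum_ne_top hω.ne
  have h1 : Tendsto (fun n => Y n ω) atTop (𝓝 0) := by
    have := (ENNReal.tendsto_toReal ENNReal.zero_ne_top).comp h0
    refine Tendsto.congr (fun n => ?_) this
    simp only [Function.comp]
    exact ENNReal.toReal_ofReal (sq_nonneg _)
  have h2 : Tendsto (fun n => (∫ s in (1:ℝ)..S n, F s ω) / D (S n)) atTop (𝓝 0) := by
    have := h1.sqrt
    simp only [hY, Real.sqrt_sq_eq_abs, Real.sqrt_zero] at this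
    exact (tendsto_zero_iff_abs_tendsto_zero _).2 this
  refine interp hM0 ?_ hdiv S hS1 hSD h2
  have hle : ∀ a b, a ≤ b → |(∫ s in (1:ℝ)..b, F s ω) - ∫ s in (1:ℝ)..a, F s ω| ≤ M * |D b - D a| := by
    intro a b hab
    simp only [hD]
    rw [intervalIntegral.integral_interval_sub_left (hFi _ _ _) (hFi _ _ _),
      intervalIntegral.integral_interval_sub_left (hdi _ _) (hdi _ _)]
    refine (intervalIntegral.abs_integral_le_integral_abs hab).trans ?_
    rw [abs_of_nonneg (intervalIntegral.integral_nonneg hab fun s _ => (hd0 s).le),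
      ← intervalIntegral.integral_const_mul]
    refine intervalIntegral.integral_mono_on hab (hFi _ _ _).abs ((hdi _ _).const_mul _) fun s _ => ?_
    simp only [F]
    rw [abs_mul, abs_of_pos (hd0 s)]
    exact mul_le_mul_of_nonneg_right (hM _ _) (hd0 s).le
  intro a b _ _
  rcases le_total a b with h | h
  · have := hle a b h
    rw [abs_sub_comm, abs_sub_comm (D a)]
    exact this
  · exact hle b a h

/-- weighted Cesaro -/
lemma cesaro (d u : ℝ → ℝ) (l : ℝ) (hd : Antitone d) (hd0 : ∀ s, 0 < d s)
    (hdiv : Tendsto (fun S : ℝ => ∫ s in (1 : ℝ)..S, d s) atTop atTop)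
    (hum : Measurable u) (K : ℝ) (hu : ∀ s, |u s| ≤ K) (hl : Tendsto u atTop (𝓝 l)) :
    Tendsto (fun S : ℝ => (∫ s in (1 : ℝ)..S, u s * d s) / ∫ s in (1 : ℝ)..S, d s)
      atTop (𝓝 l) := by
  have hdi : ∀ a b, IntervalIntegrable d volume a b := fun a b => hd.intervalIntegrable
  have hui : ∀ a b, IntervalIntegrable (fun s => u s * d s) volume a b := fun a b =>
    ⟨(hdi a b).1.bdd_mul (c := K) hum.aestronglyMeasurable (.of_forall hu),
      (hdi a b).2.bdd_mul (c := K) hum.aestronglyMeasurable (.of_forall hu)⟩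
  have hvi : ∀ a b, IntervalIntegrable (fun s => (u s - l) * d s) volume a b := fun a b => by
    simp only [sub_mul]
    exact (hui a b).sub ((hdi a b).const_mul l)
  rw [Metric.tendsto_atTop]
  intro ε hε
  obtain ⟨N, hN⟩ := Metric.tendsto_atTop.1 hl (ε / 2) (by positivity)
  set N1 := max N 1
  set c := ∫ s in (1:ℝ)..N1, |(u s - l) * d s| with hc
  obtain ⟨R, hR⟩ := (hdiv.eventually_gt_atTop (max 0 (2 * c / ε))).exists_forall_of_atTop
  refine ⟨max R N1, fun S hS => ?_⟩
  have hSR : R ≤ S := (le_max_left _ _).trans hS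
  have hSN : N1 ≤ S := (le_max_right _ _).trans hS
  have hN1 : 1 ≤ N1 := le_max_right _ _
  have hDS := hR S hSR
  set D := ∫ s in (1:ℝ)..S, d s with hD
  have hD0 : 0 < D := (le_max_left _ _).trans_lt hDS
  have hDc : 2 * c / ε < D := (le_max_right _ _).trans_lt hDS
  rw [Real.dist_eq]
  have e : (∫ s in (1 : ℝ)..S, u s * d s) / D - l = (∫ s in (1 : ℝ)..S, (u s - l) * d s) / D := by
    simp only [sub_mul]
    rw [intervalIntegral.integral_sub (hui _ _) ((hdi _ _).const_mul l),
      intervalIntegral.integral_const_mul, ← hD]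
    field_simp
  rw [e, abs_div, abs_of_pos hD0, div_lt_iff₀ hD0]
  have b1 : |∫ s in (1 : ℝ)..S, (u s - l) * d s| ≤ ∫ s in (1 : ℝ)..S, |(u s - l) * d s| :=
    intervalIntegral.abs_integral_le_integral_abs (by linarith)
  rw [← intervalIntegral.integral_add_adjacent_intervals (hvi 1 N1).abs (hvi N1 S).abs] at b1
  have b2 : ∫ s in N1..S, |(u s - l) * d s| ≤ ε / 2 * D := by
    calc ∫ s in N1..S, |(u s - l) * d s| ≤ ∫ s in N1..S, ε / 2 * d s := by
          refine intervalIntegral.integral_mono_on hSN (hvi _ _).abs ((hdi _ _).const_mul _) fun s hs => ?_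
          rw [abs_mul, abs_of_pos (hd0 s)]
          have := hN s ((le_max_left _ _).trans hs.1)
          rw [Real.dist_eq] at this
          exact mul_le_mul_of_nonneg_right this.le (hd0 s).le
      _ ≤ _ := by
          rw [intervalIntegral.integral_const_mul]
          gcongr
          exact intervalIntegral.integral_mono_interval hN1 hSN le_rfl
            (.of_forall fun s => (hd0 s).le) (hdi _ _)
  rw [div_lt_iff₀ hε] at hDc
  linarith

/-- elementary bump -/
noncomputable def bmp (a : ℚ × ℕ × ℚ) (x : ℝ) : ℝ := a.1 * max 0 (1 - a.2.1 * |x - a.2.2|)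

/-- maxima of finitely many bumps -/
noncomputable def hat (l : List (ℚ × ℕ × ℚ)) (x : ℝ) : ℝ :=
  match l with
  | [] => 0
  | a :: l => max (bmp a x) (hat l x)

lemma hat_nonneg (l : List (ℚ × ℕ × ℚ)) (x : ℝ) : 0 ≤ hat l x := by
  induction l with
  | nil => simp [hat]
  | cons a l ih => exact ih.trans (le_max_right _ _)

lemma hat_lip (l : List (ℚ × ℕ × ℚ)) : ∃ L, 0 ≤ L ∧ ∀ x y, |hat l x - hat l y| ≤ L * |x - y| := by
  induction l with
  | nil => exact ⟨0, le_rfl, by simp [hat]⟩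
  | cons a l ih =>
    obtain ⟨L, hL0, hL⟩ := ih
    refine ⟨max (|(a.1:ℝ)| * a.2.1) L, le_max_of_le_right hL0, fun x y => ?_⟩
    simp only [hat]
    refine (abs_max_sub_max_le_max _ _ _ _).trans (max_le ?_ ?_)
    · have e : bmp a x - bmp a y = a.1 * (max 0 (1 - a.2.1 * |x - a.2.2|)
          - max 0 (1 - a.2.1 * |y - a.2.2|)) := by
        simp only [bmp]; ring
      rw [e, abs_mul]
      have h1 := abs_max_sub_max_le_max 0 (1 - a.2.1 * |x - a.2.2|) 0 (1 - a.2.1 * |y - a.2.2|)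
      have e2 : (1 - a.2.1 * |x - a.2.2|) - (1 - a.2.1 * |y - a.2.2|)
        = a.2.1 * (|y - a.2.2| - |x - a.2.2|) := by ring
      rw [e2, sub_self, abs_zero, max_eq_right (abs_nonneg ((a.2.1:ℝ) * (|y - a.2.2| - |x - a.2.2|))), abs_mul, Nat.abs_cast] at h1
      have h2 : |(|y - a.2.2| - |x - a.2.2|)| ≤ |x - y| := by
        refine (abs_abs_sub_abs_le _ _).trans (le_of_eq ?_)
        rw [abs_sub_comm x y]; congr 1; ring
      calc _ ≤ |(a.1:ℝ)| * (a.2.1 * |x - y|) := by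
            gcongr
            exact h1.trans (by gcongr)
        _ = (|(a.1:ℝ)| * a.2.1) * |x - y| := by ring
        _ ≤ _ := by gcongr; exact le_max_left _ _
    · exact (hL x y).trans (mul_le_mul_of_nonneg_right (le_max_right _ _) (abs_nonneg _))

lemma hat_bdd (l : List (ℚ × ℕ × ℚ)) (g : ℝ → ℝ) (hg : ∀ x, 0 ≤ g x)
    (h : ∀ a ∈ l, ∀ x, bmp a x ≤ g x) (x : ℝ) : hat l x ≤ g x := by
  induction l with
  | nil => exact hg x
  | cons a l ih =>
    exact max_le (h a (by simp) x) (ih fun b hb => h b (by simp [hb]))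

lemma le_hat (l : List (ℚ × ℕ × ℚ)) (a) (ha : a ∈ l) (x : ℝ) : bmp a x ≤ hat l x := by
  induction l with
  | nil => simp at ha
  | cons b l ih =>
    rcases List.mem_cons.1 ha with h | h
    · subst h; exact le_max_left _ _
    · exact (ih h).trans (le_max_right _ _)

lemma hat_bdd' (l : List (ℚ × ℕ × ℚ)) : ∃ K, ∀ x, hat l x ≤ K := by
  induction l with
  | nil => exact ⟨0, fun x => le_rfl⟩
  | cons a l ih =>
    obtain ⟨K, hK⟩ := ih
    refine ⟨max |(a.1:ℝ)| K, fun x => max_le_max ?_ (hK x)⟩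
    simp only [bmp]
    have h1 : (0:ℝ) ≤ a.2.1 * |x - a.2.2| := by positivity
    have h2 : max 0 (1 - a.2.1 * |x - a.2.2|) ≤ 1 := max_le zero_le_one (by linarith)
    calc _ ≤ |(a.1:ℝ)| * max 0 (1 - a.2.1 * |x - a.2.2|) := by
          gcongr; exact le_abs_self _
      _ ≤ |(a.1:ℝ)| * 1 := by gcongr
      _ = _ := mul_one _

lemma hat_cont (l : List (ℚ × ℕ × ℚ)) : Continuous (hat l) := by
  obtain ⟨L, hL0, hL⟩ := hat_lip l
  exact (LipschitzWith.of_dist_le_mul (K := ⟨L, hL0⟩) fun x y => by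
    rw [Real.dist_eq, Real.dist_eq]; exact hL x y).continuous

lemma exists_bmp (g : ℝ → ℝ) (hg : Continuous g) (hg0 : ∀ x, 0 ≤ g x) (x a : ℝ) (ha : a < g x) :
    ∃ b, (∀ y, bmp b y ≤ g y) ∧ a < bmp b x := by
  by_cases ha0 : a < 0
  · refine ⟨(0, 0, 0), fun y => by simpa [bmp] using hg0 y, by simpa [bmp] using ha0⟩
  push Not at ha0
  obtain ⟨c, hc1, hc2⟩ := exists_rat_btwn ha
  have hc0 : (0:ℝ) < c := by linarith
  obtain ⟨δ, hδ, hδ2⟩ := Metric.eventually_nhds_iff.1 (hg.continuousAt.eventually (lt_mem_nhds hc2) :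
    ∀ᶠ y in 𝓝 x, (c:ℝ) < g y)
  obtain ⟨n, hn⟩ := exists_nat_gt (2 / δ)
  have hn0 : (0:ℝ) < n := lt_trans (by positivity) hn
  have hr : 0 < min (δ / 2) ((1 - a / c) / n) := by
    have : a / c < 1 := by rw [div_lt_one hc0]; exact hc1
    apply lt_min (by positivity) (div_pos (by linarith) hn0)
  obtain ⟨q, hq1, hq2⟩ := exists_rat_btwn (show x < x + min (δ / 2) ((1 - a / c) / n) by linarith)
  have hxq : |x - q| < min (δ / 2) ((1 - a / c) / n) := by
    rw [abs_lt]; constructor <;> linarith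
  refine ⟨(c, n, q), fun y => ?_, ?_⟩
  · simp only [bmp]
    by_cases hy : 1 - (n:ℝ) * |y - q| ≤ 0
    · rw [max_eq_left hy, mul_zero]; exact hg0 y
    · push Not at hy
      rw [max_eq_right hy.le]
      have h1 : |y - q| < δ / 2 := by
        rw [div_lt_iff₀ hδ] at hn
        by_contra hcon
        push Not at hcon
        nlinarith
      have h2 : dist y x < δ := by
        rw [Real.dist_eq]
        have := abs_sub_le y q x
        rw [abs_sub_comm (q:ℝ) x] at this
        linarith [hxq.trans_le (min_le_left _ _)]
      have := hδ2 h2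
      have h3 : 0 ≤ (n:ℝ) * |y - q| := by positivity
      nlinarith
  · simp only [bmp]
    have h1 := hxq.trans_le (min_le_right _ _)
    rw [lt_div_iff₀ hn0] at h1
    have h2 : a / c < max 0 (1 - (n:ℝ) * |x - q|) := lt_max_of_lt_right (by linarith)
    rw [div_lt_iff₀ hc0] at h2
    linarith

lemma approx (g : ℝ → ℝ) (hg : Continuous g) (hg0 : ∀ x, 0 ≤ g x) :
    ∃ l : ℕ → List (ℚ × ℕ × ℚ), (∀ n x, hat (l n) x ≤ g x) ∧
      ∀ x, Tendsto (fun n => hat (l n) x) atTop (𝓝 (g x)) := by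
  classical
  obtain ⟨e, he⟩ := exists_surjective_nat (ℚ × ℕ × ℚ)
  let l : ℕ → List (ℚ × ℕ × ℚ) := fun n =>
    ((List.range n).map e).filter (fun a => decide (∀ y, bmp a y ≤ g y))
  have hle : ∀ n x, hat (l n) x ≤ g x := fun n x => by
    refine hat_bdd _ _ hg0 (fun a ha => ?_) x
    simpa using (List.mem_filter.1 ha).2
  refine ⟨l, hle, fun x => ?_⟩
  rw [tendsto_order]
  refine ⟨fun a ha => ?_, fun a ha => .of_forall fun n => (hle n x).trans_lt ha⟩
  obtain ⟨b, hb1, hb2⟩ := exists_bmp g hg hg0 x a ha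
  obtain ⟨k, rfl⟩ := he b
  filter_upwards [eventually_gt_atTop k] with n hn
  refine hb2.trans_le (le_hat _ _ ?_ x)
  refine List.mem_filter.2 ⟨List.mem_map.2 ⟨k, List.mem_range.2 hn, rfl⟩, by simpa using hb1⟩

lemma weak_lower (μ : Measure ℝ) [IsProbabilityMeasure μ] (d Z : ℝ → ℝ) (hd : Antitone d)
    (hd0 : ∀ s, 0 < d s) (hdiv : Tendsto (fun S : ℝ => ∫ s in (1 : ℝ)..S, d s) atTop atTop)
    (hZ : Measurable Z)
    (hl : ∀ l, Tendsto (fun S : ℝ => (∫ s in (1 : ℝ)..S, hat l (Z s) * d s) /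
      ∫ s in (1 : ℝ)..S, d s) atTop (𝓝 (∫ y, hat l y ∂μ)))
    (g : ℝ → ℝ) (hg : Continuous g) (hg0 : ∀ x, 0 ≤ g x) (K : ℝ) (hK : ∀ x, g x ≤ K)
    (ε : ℝ) (hε : 0 < ε) :
    ∀ᶠ S : ℝ in atTop, ∫ y, g y ∂μ - ε < (∫ s in (1 : ℝ)..S, g (Z s) * d s) /
      ∫ s in (1 : ℝ)..S, d s := by
  have hdi : ∀ a b, IntervalIntegrable d volume a b := fun a b => hd.intervalIntegrable
  have hii : ∀ {u : ℝ → ℝ}, Continuous u → (∀ x, 0 ≤ u x) → (∀ x, u x ≤ K) → ∀ a b,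
      IntervalIntegrable (fun s => u (Z s) * d s) volume a b := fun {u} hu hu0 huK a b => by
    have hb : ∀ s, ‖u (Z s)‖ ≤ K := fun s => by
      rw [Real.norm_eq_abs, abs_of_nonneg (hu0 _)]; exact huK _
    have hm := (hu.measurable.comp hZ).aestronglyMeasurable (μ := (volume : Measure ℝ))
    exact ⟨(hdi a b).1.bdd_mul (c := K) hm.restrict (.of_forall hb),
      (hdi a b).2.bdd_mul (c := K) hm.restrict (.of_forall hb)⟩
  obtain ⟨l, hle, hlim⟩ := approx g hg hg0
  have hdct : Tendsto (fun n => ∫ y, hat (l n) y ∂μ) atTop (𝓝 (∫ y, g y ∂μ)) := by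
    refine tendsto_integral_of_dominated_convergence (fun _ => K)
      (fun n => (hat_cont _).aestronglyMeasurable) (integrable_const _) (fun n => .of_forall fun x => ?_)
      (.of_forall hlim)
    rw [Real.norm_eq_abs, abs_of_nonneg (hat_nonneg _ _)]
    exact (hle n x).trans (hK x)
  obtain ⟨n, hn⟩ := (hdct.eventually (lt_mem_nhds (show ∫ y, g y ∂μ - ε / 2 < _ by linarith))).exists
  filter_upwards [(hl (l n)).eventually (lt_mem_nhds (show ∫ y, hat (l n) y ∂μ - ε / 2 < _ by linarith)),
    eventually_ge_atTop 1] with S hS hS1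
  have hD : 0 ≤ ∫ s in (1 : ℝ)..S, d s := intervalIntegral.integral_nonneg hS1 fun s _ => (hd0 s).le
  have : (∫ s in (1 : ℝ)..S, hat (l n) (Z s) * d s) / ∫ s in (1 : ℝ)..S, d s ≤
      (∫ s in (1 : ℝ)..S, g (Z s) * d s) / ∫ s in (1 : ℝ)..S, d s := by
    refine div_le_div_of_nonneg_right ?_ hD
    refine intervalIntegral.integral_mono_on hS1 (hii (hat_cont _) (hat_nonneg _)
      (fun x => (hle n x).trans (hK x)) _ _) (hii hg hg0 hK _ _) fun s _ => ?_
    exact mul_le_mul_of_nonneg_right (hle _ _) (hd0 s).le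
  linarith

lemma weak_conv (μ : Measure ℝ) [IsProbabilityMeasure μ] (d Z : ℝ → ℝ) (hd : Antitone d)
    (hd0 : ∀ s, 0 < d s) (hdiv : Tendsto (fun S : ℝ => ∫ s in (1 : ℝ)..S, d s) atTop atTop)
    (hZ : Measurable Z)
    (hl : ∀ l, Tendsto (fun S : ℝ => (∫ s in (1 : ℝ)..S, hat l (Z s) * d s) /
      ∫ s in (1 : ℝ)..S, d s) atTop (𝓝 (∫ y, hat l y ∂μ)))
    (g : BoundedContinuousFunction ℝ ℝ) :
    Tendsto (fun S : ℝ => (∫ s in (1 : ℝ)..S, g (Z s) * d s) /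
      ∫ s in (1 : ℝ)..S, d s) atTop (𝓝 (∫ y, g y ∂μ)) := by
  have hdi : ∀ a b, IntervalIntegrable d volume a b := fun a b => hd.intervalIntegrable
  have hgi : ∀ a b, IntervalIntegrable (fun s => g (Z s) * d s) volume a b := fun a b => by
    have hm := (g.continuous.measurable.comp hZ).aestronglyMeasurable (μ := (volume : Measure ℝ))
    exact ⟨(hdi a b).1.bdd_mul (c := ‖g‖) hm.restrict (.of_forall fun s => g.norm_coe_le_norm _),
      (hdi a b).2.bdd_mul (c := ‖g‖) hm.restrict (.of_forall fun s => g.norm_coe_le_norm _)⟩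
  have hb : ∀ x, |g x| ≤ ‖g‖ := fun x => g.norm_coe_le_norm x
  have hgμ : Integrable g μ := g.integrable μ
  rw [Metric.tendsto_nhds]
  intro ε hε
  have k1 := weak_lower μ d Z hd hd0 hdiv hZ hl (fun x => ‖g‖ + g x) (by fun_prop)
    (fun x => by linarith [(abs_le.1 (hb x)).1]) (2 * ‖g‖)
    (fun x => by linarith [(abs_le.1 (hb x)).2]) ε hε
  have k2 := weak_lower μ d Z hd hd0 hdiv hZ hl (fun x => ‖g‖ - g x) (by fun_prop)
    (fun x => by linarith [(abs_le.1 (hb x)).2]) (2 * ‖g‖)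
    (fun x => by linarith [(abs_le.1 (hb x)).1]) ε hε
  filter_upwards [k1, k2, hdiv.eventually_gt_atTop 0] with S h1 h2 hD
  simp only [add_mul, sub_mul] at h1 h2
  rw [integral_add (integrable_const _) hgμ, intervalIntegral.integral_add ((hdi _ _).const_mul _) (hgi _ _),
    intervalIntegral.integral_const_mul, add_div, mul_div_cancel_right₀ _ hD.ne'] at h1
  rw [integral_sub (integrable_const _) hgμ, intervalIntegral.integral_sub ((hdi _ _).const_mul _) (hgi _ _),
    intervalIntegral.integral_const_mul, _root_.sub_div, mul_div_cancel_right₀ _ hD.ne'] at h2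
  simp only [integral_const, probReal_univ, one_smul] at h1 h2
  rw [Real.dist_eq, abs_lt]
  constructor <;> linarith

lemma d_bound (d : ℝ → ℝ) (hd_pos : ∀ s, 1 ≤ s → 0 < d s)
    (hd_dec : ∀ x y : ℝ, 1 ≤ x → x ≤ y → d y ≤ d x)
    (hd_sum : ∀ k : ℕ, 1 ≤ k →
      ∫ s in (k : ℝ)..((k : ℝ) + 1), d s ≤ Real.log (Real.sqrt (((k : ℝ) + 1) / k)))
    (s : ℝ) (hs : 1 ≤ s) : d s ≤ (2 * d 1 + 2) / s := by
  have hs0 : 0 < s := by linarith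
  have hd1 := hd_pos 1 le_rfl
  rw [le_div_iff₀ hs0]
  by_cases h2 : s < 2
  · have := hd_dec 1 s le_rfl hs
    have h0 := hd_pos s hs
    nlinarith
  push Not at h2
  have hfl : 2 ≤ ⌊s⌋₊ := Nat.le_floor (by simpa using h2)
  obtain ⟨k, hk⟩ : ∃ k, ⌊s⌋₊ = k + 1 := ⟨⌊s⌋₊ - 1, by omega⟩
  have hk1 : 1 ≤ k := by omega
  have hk1' : (1:ℝ) ≤ k := by exact_mod_cast hk1
  have c1 := Nat.floor_le hs0.le
  have c2 := Nat.lt_floor_add_one s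
  rw [hk] at c1 c2
  push_cast at c1 c2
  have hint : IntervalIntegrable d volume k (k + 1) := by
    apply AntitoneOn.intervalIntegrable
    intro x hx y hy hxy
    rw [Set.uIcc_of_le (by linarith)] at hx
    exact hd_dec x y (by linarith [hx.1]) hxy
  have i1 : d s ≤ ∫ u in (k : ℝ)..((k : ℝ) + 1), d u := by
    have : ∫ u in (k : ℝ)..((k : ℝ) + 1), d s ≤ ∫ u in (k : ℝ)..((k : ℝ) + 1), d u := by
      refine intervalIntegral.integral_mono_on (by linarith) intervalIntegrable_const hint fun u hu => ?_
      exact hd_dec u s (by linarith [hu.1]) (by linarith [hu.2])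
    simpa using this
  have i2 := hd_sum k hk1
  have i3 : Real.log (Real.sqrt (((k : ℝ) + 1) / k)) ≤ 1 / (2 * k) := by
    rw [Real.log_sqrt (by positivity)]
    have := Real.log_le_sub_one_of_pos (show 0 < ((k : ℝ) + 1) / k by positivity)
    have e : ((k : ℝ) + 1) / k - 1 = 1 / k := by field_simp; ring
    rw [e] at this
    calc _ ≤ 1 / (k:ℝ) / 2 := by gcongr
      _ = _ := by field_simp
  have i4 : d s ≤ 1 / (2 * k) := by linarith
  rw [le_div_iff₀ (by positivity)] at i4
  have h0 := hd_pos s hs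
  nlinarith

/-- **One-dimensional marginal form of Theorem 4 (integral-type almost sure CLT).**
Assume `f` satisfies condition (B) (`f(x)/x^β` increasing for some `β > 0`) and `d`
satisfies condition (C) (decreasing, `∫_k^{k+1} d ≤ log √((k+1)/k)`, `∫_1^∞ d = ∞`).
Then almost surely the averages
`(1/D(S)) ∫_1^S g (V(f(s))/√f(s)) d(s) ds`, with `D(S) = ∫_1^S d(s) ds`, converge to
`∫ g dN(0, σ²)` for every bounded continuous `g`. -/
theorem stmt10
    {Ω : Type*} [MeasurableSpace Ω] (P : Measure Ω) [IsProbabilityMeasure P]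
    (V : ℝ → Ω → ℝ) (σ : ℝ≥0)
    (hVmeas : ∀ t, Measurable (V t))
    (hV0 : ∀ᵐ ω ∂P, V 0 ω = 0)
    (hindep : ∀ (k : ℕ) (t : Fin (k + 1) → ℝ), Monotone t → 0 ≤ t 0 →
      iIndepFun
        (fun i : Fin k => fun ω => V (t i.succ) ω - V (t i.castSucc) ω) P)
    (hstat : ∀ s t : ℝ, 0 ≤ s → s ≤ t →
      Measure.map (fun ω => V t ω - V s ω) P = Measure.map (V (t - s)) P)
    (hL2 : MemLp (V 1) 2 P)
    (hcent : ∫ ω, V 1 ω ∂P = 0)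
    (hvar : ∫ ω, (V 1 ω) ^ 2 ∂P = (σ : ℝ) ^ 2)
    (f : ℝ → ℝ) (hf_pos : ∀ x, 1 ≤ x → 0 < f x)
    (β : ℝ) (hβ : 0 < β)
    (hB : ∀ x y : ℝ, 1 ≤ x → x ≤ y → f x / x ^ β ≤ f y / y ^ β)
    (d : ℝ → ℝ) (hd_pos : ∀ s, 1 ≤ s → 0 < d s)
    (hd_dec : ∀ x y : ℝ, 1 ≤ x → x ≤ y → d y ≤ d x)
    (hd_sum : ∀ k : ℕ, 1 ≤ k →
      ∫ s in (k : ℝ)..((k : ℝ) + 1), d s ≤ Real.log (Real.sqrt (((k : ℝ) + 1) / k)))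
    (hd_div : Tendsto (fun S : ℝ => ∫ s in (1 : ℝ)..S, d s) atTop atTop)
    (hjoint : Measurable (Function.uncurry fun (s : ℝ) (ω : Ω) => V (f s) ω)) :
    ∀ᵐ ω ∂P, ∀ g : BoundedContinuousFunction ℝ ℝ,
      Tendsto (fun S : ℝ =>
          (1 / ∫ s in (1 : ℝ)..S, d s) *
            ∫ s in (1 : ℝ)..S, g (V (f s) ω / Real.sqrt (f s)) * d s) atTop
        (𝓝 (∫ y, g y ∂(gaussianReal 0 (σ ^ 2)))) := by
  have H : LevyH P V σ := ⟨hVmeas, hV0, hindep, hstat, hL2, hcent, hvar⟩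
  have hm : ∀ t, 0 ≤ t → ∫ ω, V t ω ∂P = 0 := fun t ht => H.mean f hf_pos β hβ hB hjoint ht
  -- ratio bounds for f
  have hratio : ∀ s t, 1 ≤ s → s ≤ t → f s / f t ≤ (s / t) ^ β := by
    intro s t hs hst
    have hs0 : 0 < s := by linarith
    have ht0 : 0 < t := by linarith
    have := hB s t hs hst
    rw [div_le_div_iff₀ (by positivity) (by positivity)] at this
    rw [Real.div_rpow hs0.le ht0.le, div_le_div_iff₀ (hf_pos t (by linarith)) (by positivity)]
    linarith
  have hfmono : ∀ s t, 1 ≤ s → s ≤ t → f s ≤ f t := by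
    intro s t hs hst
    have ht0 := hf_pos t (by linarith)
    have h1 := hratio s t hs hst
    have h2 : (s / t) ^ β ≤ 1 := Real.rpow_le_one (div_nonneg (by linarith) (by linarith))
      (by rw [div_le_one (by linarith)]; exact hst) hβ.le
    rw [← div_le_one ht0]
    exact h1.trans h2
  have hftop : Tendsto f atTop atTop := by
    have h1 : Tendsto (fun s : ℝ => f 1 * s ^ β) atTop atTop :=
      (_root_.tendsto_rpow_atTop hβ).const_mul_atTop (hf_pos 1 le_rfl)
    refine tendsto_atTop_mono' _ ?_ h1
    filter_upwards [eventually_ge_atTop 1] with s hs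
    have := hB 1 s le_rfl hs
    rw [Real.one_rpow, div_one, le_div_iff₀ (by positivity)] at this
    exact this
  -- regularized versions
  let f' : ℝ → ℝ := fun s => f (max 1 s)
  have hf'm : Monotone f' := fun x y hxy => hfmono _ _ (le_max_left _ _) (max_le_max le_rfl hxy)
  have hf' : ∀ s, 1 ≤ s → f' s = f s := fun s hs => by simp only [f', max_eq_right hs]
  let d' : ℝ → ℝ := fun s => d (max 1 s)
  have hd'a : Antitone d' := fun x y hxy => hd_dec _ _ (le_max_left _ _) (max_le_max le_rfl hxy)
  have hd' : ∀ s, 1 ≤ s → d' s = d s := fun s hs => by simp only [d', max_eq_right hs]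
  have hd'0 : ∀ s, 0 < d' s := fun s => hd_pos _ (le_max_left _ _)
  have hd'1 : ∀ s, d' s ≤ d' 1 := fun s => by
    rw [hd' 1 le_rfl]; exact hd_dec 1 _ le_rfl (le_max_left _ _)
  have hDeq : ∀ S, 1 ≤ S → ∫ s in (1:ℝ)..S, d s = ∫ s in (1:ℝ)..S, d' s := fun S hS =>
    intervalIntegral.integral_congr fun s hs => by
      rw [Set.uIcc_of_le hS] at hs; exact (hd' s hs.1).symm
  have hdiv' : Tendsto (fun S : ℝ => ∫ s in (1 : ℝ)..S, d' s) atTop atTop := by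
    refine hd_div.congr' ?_
    filter_upwards [eventually_ge_atTop 1] with S hS using hDeq S hS
  have hdC : ∀ s, 1 ≤ s → d' s ≤ (2 * d 1 + 2) / s := fun s hs => by
    rw [hd' s hs]; exact d_bound d hd_pos hd_dec hd_sum s hs
  let Z : ℝ → Ω → ℝ := fun s ω => V (f s) ω / √(f' s)
  have hZm : Measurable (Function.uncurry Z) :=
    hjoint.div ((hf'm.measurable.comp measurable_fst).sqrt)
  -- test functions
  have hkey : ∀ l : List (ℚ × ℕ × ℚ), ∀ᵐ ω ∂P,
      Tendsto (fun S : ℝ => (∫ s in (1 : ℝ)..S, hat l (Z s ω) * d' s) /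
        ∫ s in (1 : ℝ)..S, d' s) atTop (𝓝 (∫ y, hat l y ∂(gaussianReal 0 (σ ^ 2)))) := by
    intro l
    obtain ⟨L, hL0, hL⟩ := hat_lip l
    obtain ⟨K, hK⟩ := hat_bdd' l
    let g : BoundedContinuousFunction ℝ ℝ := BoundedContinuousFunction.ofNormedAddCommGroup
      (hat l) (hat_cont l) K (fun x => by
        rw [Real.norm_eq_abs, abs_of_nonneg (hat_nonneg l x)]; exact hK x)
    have hgL : ∀ x y, |g x - g y| ≤ L * |x - y| := hL
    have hgb : ∀ x, |g x| ≤ ‖g‖ := fun x => g.norm_coe_le_norm x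
    let u : ℝ → ℝ := fun s => ∫ ω, g (Z s ω) ∂P
    have hgZm : Measurable (fun p : ℝ × Ω => g (Z p.1 p.2)) := g.continuous.measurable.comp hZm
    have hum : Measurable u := hgZm.stronglyMeasurable.integral_prod_right'.measurable
    have hub : ∀ s, |u s| ≤ ‖g‖ := fun s => by
      have := norm_integral_le_of_norm_le_const (μ := P) (f := fun ω => g (Z s ω)) (C := ‖g‖)
        (.of_forall fun ω => g.norm_coe_le_norm _)
      simpa using this
    have hZs : ∀ s, 1 ≤ s → ∀ ω, Z s ω = V (f s) ω / √(f s) := fun s hs ω => by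
      simp only [Z, hf' s hs]
    have hulim : Tendsto u atTop (𝓝 (∫ y, g y ∂(gaussianReal 0 (σ ^ 2)))) := by
      refine ((H.clt hm g L hgL).comp hftop).congr' ?_
      filter_upwards [eventually_ge_atTop 1] with s hs
      simp only [Function.comp, u, hZs s hs]
    have hav := as_avg (P := P) (fun s ω => g (Z s ω) - u s)
      (hgZm.sub (hum.comp measurable_fst)) (2 * ‖g‖)
      (fun s ω => by linarith [abs_sub (g (Z s ω)) (u s), hgb (Z s ω), hub s])
      (2 * ‖g‖ * L * σ) (β / 2) (2 * d 1 + 2) (by positivity) (by positivity)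
      (by linarith [hd_pos 1 le_rfl])
      (fun s t hs hst => by
        have h1 := H.cov hm g L hgL (hf_pos s hs) (hfmono s t hs hst)
        simp only [u, hZs s hs, hZs t (hs.trans hst)]
        refine h1.trans ?_
        gcongr
        have hst0 : 0 ≤ s / t := div_nonneg (by linarith) (by linarith)
        rw [show β / 2 = β * (1 / 2) by ring, Real.rpow_mul hst0, ← Real.sqrt_eq_rpow]
        exact Real.sqrt_le_sqrt (hratio s t hs hst))
      d' hd'a hd'0 hd'1 hdC hdiv'
    have hces := cesaro d' u _ hd'a hd'0 hdiv' hum ‖g‖ hub hulim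
    have hdi : ∀ a b, IntervalIntegrable d' volume a b := fun a b => hd'a.intervalIntegrable
    have hbi : ∀ {w : ℝ → ℝ}, Measurable w → (∀ s, |w s| ≤ ‖g‖) → ∀ a b,
        IntervalIntegrable (fun s => w s * d' s) volume a b := fun hw hwb a b =>
      ⟨(hdi a b).1.bdd_mul (c := ‖g‖) hw.aestronglyMeasurable (.of_forall hwb),
        (hdi a b).2.bdd_mul (c := ‖g‖) hw.aestronglyMeasurable (.of_forall hwb)⟩
    filter_upwards [hav] with ω hω
    have := hω.add hces
    rw [zero_add] at this
    refine this.congr fun S => ?_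
    simp only [sub_mul]
    have hq : IntervalIntegrable (fun s => g (Z s ω) * d' s) volume 1 S :=
      hbi (w := fun s => g (Z s ω))
        (hgZm.comp (by fun_prop : Measurable fun s : ℝ => (s, ω))) (fun s => hgb _) _ _
    rw [intervalIntegral.integral_sub hq (hbi hum hub _ _), ← _root_.add_div, sub_add_cancel]
    rfl
  filter_upwards [ae_all_iff.2 hkey] with ω hω g
  have hw := weak_conv (gaussianReal 0 (σ ^ 2)) d' (fun s => Z s ω) hd'a hd'0 hdiv'
    (hZm.comp (by fun_prop : Measurable fun s : ℝ => (s, ω))) hω g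
  refine hw.congr' ?_
  filter_upwards [eventually_ge_atTop 1] with S hS
  rw [hDeq S hS, one_div, div_eq_inv_mul]
  congr 1
  refine intervalIntegral.integral_congr fun s hs => ?_
  rw [Set.uIcc_of_le hS] at hs
  simp only [Z, hf' s hs.1, hd' s hs.1]
end
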